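/- In the Artin–Schreier–Witt tower setting of length n+1 (with n ≥ 1), let w = y_n^p − y_n (which lies in L_n), let M = max_{0≤i≤n} p^{n−i} ν_i, and let μ_n = deg𝔇_{L_n/K} − p^n + 1. Then there exists h ∈ L_n such that v_{L_n}( w − (h^p − h) ) = −( p^n·M − μ_n ). -/

import Mathlib

set_option synthInstance.maxHeartbeats 1000000
set_option maxHeartbeats 1600000

/-- The Frobenius on truncated Witt vectors over a ring of characteristic `p`: it raises
each component to the `p`-th power. -/
noncomputable def twFrobenius (p m : ℕ) {R : Type*} [CommRing R]
    (x : TruncatedWittVector p m R) : TruncatedWittVector p m R :=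
  TruncatedWittVector.mk p fun i => x.coeff i ^ p

/-- Componentwise application of a ring homomorphism to a truncated Witt vector. -/
noncomputable def twMap (p m : ℕ) {R S : Type*} [CommRing R] [CommRing S]
    (f : R →+* S) (x : TruncatedWittVector p m R) : TruncatedWittVector p m S :=
  TruncatedWittVector.mk p fun i => f (x.coeff i)

/-- A (rank-one) additive valuation on a field, written additively with value `⊤` at `0`. -/
def IsAddValuation {L : Type*} [Field L] (v : L → WithTop ℤ) : Prop :=
  (∀ x, v x = ⊤ ↔ x = 0) ∧ (∀ x y, v (x * y) = v x + v y) ∧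
    (∀ x y, min (v x) (v y) ≤ v (x + y))

namespace WittVector

variable {p : ℕ}

theorem coeff_init {R : Type*} [CommRing R] (x : WittVector p R) (n i : ℕ) :
    (init n x).coeff i = if i < n then x.coeff i else 0 := by
  by_cases hi : i < n <;> simp [init, coeff_select, selectPoly, hi]

theorem coeff_tail {R : Type*} [CommRing R] (x : WittVector p R) (n i : ℕ) :
    (tail n x).coeff i = if n ≤ i then x.coeff i else 0 := by
  by_cases hi : n ≤ i <;> simp [tail, coeff_select, selectPoly, hi]

variable [hp : Fact p.Prime]

theorem coeff_add_mem {R : Type*} [CommRing R] (S : Subring R) {x y : WittVector p R}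
    (hx : ∀ i, x.coeff i ∈ S) (hy : ∀ i, y.coeff i ∈ S) (i : ℕ) : (x + y).coeff i ∈ S := by
  have h : WittVector.map S.subtype
      (WittVector.mk p (fun i => ⟨x.coeff i, hx i⟩) + WittVector.mk p fun i => ⟨y.coeff i, hy i⟩) =
      x + y := by
    rw [map_add]
    congr 1
  rw [← h, WittVector.map_coeff]
  exact Subtype.property _

theorem coeff_add_of_forall_lt_eq_zero {R : Type*} [CommRing R] (x b : WittVector p R) (n : ℕ)
    (hb : ∀ i < n, b.coeff i = 0) :
    (∀ i < n, (x + b).coeff i = x.coeff i) ∧ (x + b).coeff n = x.coeff n + b.coeff n := by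
  have htail : ∀ i < n, (tail n x).coeff i = 0 := fun i hi => by
    rw [coeff_tail, if_neg (by omega)]
  have hadd : x + b = init n x + verschiebung^[n] ((tail n x).shift n + b.shift n) := by
    conv_lhs => rw [← init_add_tail x n]
    rw [iterate_map_add, ← eq_iterate_verschiebung hb, ← eq_iterate_verschiebung htail, add_assoc]
  have hlow : ∀ (z : WittVector p R) (i : ℕ), i < n → (verschiebung^[n] z).coeff i = 0 := by
    intro z
    clear * -
    induction n with
    | zero => simp
    | succ n ih =>
      intro i hi
      rw [Function.iterate_succ_apply']
      cases i with
      | zero => exact verschiebung_coeff_zero _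
      | succ i => rw [verschiebung_coeff_succ]; exact ih i (by omega)
  have hdis : ∀ i, (init n x).coeff i = 0 ∨
      (verschiebung^[n] ((tail n x).shift n + b.shift n)).coeff i = 0 := by
    intro i
    rcases lt_or_ge i n with hi | hi
    · exact Or.inr (hlow _ i hi)
    · left
      rw [coeff_init, if_neg (by omega)]
  constructor
  · intro i hi
    rw [hadd, coeff_add_of_disjoint _ _ _ hdis, hlow _ i hi, coeff_init, if_pos hi, add_zero]
  · have h0 := iterate_verschiebung_coeff ((tail n x).shift n + b.shift n) n 0
    rw [zero_add] at h0
    rw [hadd, coeff_add_of_disjoint _ _ _ hdis, h0, coeff_init, if_neg (lt_irrefl n), zero_add,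
      add_coeff_zero, shift_coeff, shift_coeff, coeff_tail]
    simp

theorem ext_ghostComponent_mvPolynomial {σ : Type*} {x y : WittVector p (MvPolynomial σ ℤ)}
    (h : ∀ n, ghostComponent n x = ghostComponent n y) : x = y := by
  have hinj : Function.Injective (MvPolynomial.map (σ := σ) (Int.castRingHom ℚ)) :=
    MvPolynomial.map_injective _ Int.cast_injective
  apply map_injective _ hinj
  have : Invertible (p : ℚ) := invertibleOfNonzero (by exact_mod_cast hp.out.ne_zero)
  have : Invertible (p : MvPolynomial σ ℚ) :=
    (Invertible.map (MvPolynomial.C (σ := σ) (R := ℚ)) (p : ℚ)).copy _ (by simp)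
  apply (ghostMap.bijective_of_invertible p (MvPolynomial σ ℚ)).1
  ext1 n
  have h := congrArg (MvPolynomial.map (σ := σ) (Int.castRingHom ℚ)) (h n)
  simp only [ghostMap_apply, ghostComponent_apply, aeval_wittPolynomial, map_coeff] at h ⊢
  simpa using h

theorem coeff_teichmuller_mul {R : Type*} [CommRing R] (a : R) (x : WittVector p R) (i : ℕ) :
    (teichmuller p a * x).coeff i = a ^ p ^ i * x.coeff i := by
  let f : MvPolynomial (Option ℕ) ℤ →+* R :=
    MvPolynomial.eval₂Hom (Int.castRingHom R) fun z => z.elim a x.coeff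
  have ha : f (MvPolynomial.X none) = a := MvPolynomial.eval₂Hom_X' _ _ _
  have hx (i) : f (MvPolynomial.X (some i)) = x.coeff i := MvPolynomial.eval₂Hom_X' _ _ _
  have hX : map f (mk p fun i => MvPolynomial.X (some i)) = x := by
    ext i
    rw [map_coeff, coeff_mk, hx]
  have key : teichmuller p (MvPolynomial.X none) * (mk p fun i => MvPolynomial.X (some i)) =
      mk p fun i => (MvPolynomial.X none : MvPolynomial (Option ℕ) ℤ) ^ p ^ i *
        MvPolynomial.X (some i) := by
    apply ext_ghostComponent_mvPolynomial
    intro n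
    rw [map_mul, ghostComponent_teichmuller]
    simp only [ghostComponent_apply, aeval_wittPolynomial, Finset.mul_sum, coeff_mk]
    refine Finset.sum_congr rfl fun i hi => ?_
    rw [mul_pow, ← pow_mul, ← pow_add, Nat.add_sub_cancel' (Finset.mem_range_succ_iff.1 hi)]
    ring
  have := congrArg (fun z => (map f z).coeff i) key
  simpa only [map_mul, map_teichmuller, ha, hX, map_coeff, coeff_mk, hx, map_pow] using this

theorem derivation_ghostComponent {S B N : Type*} [CommRing S] [CommRing B] [Algebra S B]
    [AddCommGroup N] [Module B N] [Module S N]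
    (d : Derivation S B N) (z : WittVector p B) (n : ℕ) :
    d (ghostComponent n z) = (p ^ n : ℕ) •
      ∑ i ∈ Finset.range (n + 1), z.coeff i ^ (p ^ (n - i) - 1) • d (z.coeff i) := by
  rw [ghostComponent_apply, aeval_wittPolynomial, map_sum, Finset.smul_sum]
  refine Finset.sum_congr rfl fun i hi => ?_
  have hpn : p ^ i * p ^ (n - i) = p ^ n := by
    rw [← pow_add, Nat.add_sub_cancel' (Finset.mem_range_succ_iff.1 hi)]
  have h1 : ((p : B) ^ i * z.coeff i ^ p ^ (n - i)) = (p ^ i : ℕ) • z.coeff i ^ p ^ (n - i) := by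
    rw [nsmul_eq_mul, Nat.cast_pow]
  rw [h1, map_nsmul, d.leibniz_pow, ← hpn, mul_smul]

/-- The map `x ↦ ∑ xᵢ ^ (p ^ (n - i) - 1) dxᵢ` on Witt vectors is additive. -/
theorem sum_pow_smul_derivation_add {R : Type*} [CommRing R] {M : Type*} [AddCommGroup M]
    [Module R M] (D : Derivation ℤ R M) (x y : WittVector p R) (n : ℕ) :
    ∑ i ∈ Finset.range (n + 1), (x + y).coeff i ^ (p ^ (n - i) - 1) • D ((x + y).coeff i) =
      ∑ i ∈ Finset.range (n + 1), x.coeff i ^ (p ^ (n - i) - 1) • D (x.coeff i) +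
      ∑ i ∈ Finset.range (n + 1), y.coeff i ^ (p ^ (n - i) - 1) • D (y.coeff i) := by
  let X : WittVector p (MvPolynomial (Fin 2 × ℕ) ℤ) := mk p fun i => MvPolynomial.X (0, i)
  let Y : WittVector p (MvPolynomial (Fin 2 × ℕ) ℤ) := mk p fun i => MvPolynomial.X (1, i)
  let c : Fin 2 × ℕ → R := fun z => if z.1 = 0 then x.coeff z.2 else y.coeff z.2
  let f : MvPolynomial (Fin 2 × ℕ) ℤ →+* R := MvPolynomial.eval₂Hom (Int.castRingHom R) c
  have hfX (z) : f (MvPolynomial.X z) = c z := MvPolynomial.eval₂Hom_X' _ _ _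
  have hX : map f X = x := by
    ext i
    rw [map_coeff, coeff_mk, hfX]
    simp [c]
  have hY : map f Y = y := by
    ext i
    rw [map_coeff, coeff_mk, hfX]
    simp [c]
  let : Module (MvPolynomial (Fin 2 × ℕ) ℤ) M := Module.compHom M f
  have hsmul (a : MvPolynomial (Fin 2 × ℕ) ℤ) (m : M) : a • m = f a • m := rfl
  let d : Derivation ℤ (MvPolynomial (Fin 2 × ℕ) ℤ) (Fin 2 × ℕ →₀ MvPolynomial (Fin 2 × ℕ) ℤ) :=
    MvPolynomial.mkDerivation ℤ fun z => Finsupp.single z 1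
  let g : (Fin 2 × ℕ →₀ MvPolynomial (Fin 2 × ℕ) ℤ) →ₗ[MvPolynomial (Fin 2 × ℕ) ℤ] M :=
    Finsupp.linearCombination _ fun z => D (c z)
  have hg (P : MvPolynomial (Fin 2 × ℕ) ℤ) : g (d P) = D (f P) := by
    induction P using MvPolynomial.induction_on with
    | C a =>
      have h1 : f (MvPolynomial.C a) = (a : R) := by simp [f]
      rw [h1, D.map_intCast, ← MvPolynomial.algebraMap_eq, Derivation.map_algebraMap, map_zero]
    | add P Q hP hQ => rw [map_add, map_add, map_add, map_add, hP, hQ]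
    | mul_X P z hP =>
      have h1 : g (d (MvPolynomial.X z)) = D (f (MvPolynomial.X z)) := by
        simp only [d, g, MvPolynomial.mkDerivation_X, Finsupp.linearCombination_single, hfX,
          one_smul]
      rw [Derivation.leibniz, map_add, map_smul, map_smul, hP, h1, map_mul, Derivation.leibniz,
        hsmul, hsmul]
  have h0 := derivation_ghostComponent d (X + Y) n
  rw [map_add, map_add, derivation_ghostComponent, derivation_ghostComponent, ← smul_add] at h0
  have h1 := smul_right_injective _ (pow_ne_zero n hp.out.ne_zero) h0
  have h2 := congrArg g h1
  simp only [map_add, map_sum, map_smul, hg, hsmul, map_pow] at h2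
  simp only [← map_coeff, map_add, hX, hY] at h2
  exact h2.symm

end WittVector

section FrobeniusDigits

variable {p : ℕ} [Fact p.Prime] {E : Type*} [Field E] [CharP E p]

/-- The powers `1, x, …, x ^ (p - 1)` span `E` over the subfield of `p`-th powers. -/
def SpansOverPowers (p : ℕ) {E : Type*} [Field E] (x : E) : Prop :=
  ∀ z : E, ∃ a : ℕ → E, z = ∑ i ∈ Finset.range p, x ^ i * a i ^ p

/-- The powers `1, x, …, x ^ (p - 1)` are independent over the subfield of `p`-th powers. -/
def IndepOverPowers (p : ℕ) {E : Type*} [Field E] (x : E) : Prop :=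
  ∀ a : ℕ → E, ∑ i ∈ Finset.range p, x ^ i * a i ^ p = 0 → ∀ i < p, a i = 0

theorem SpansOverPowers.span_eq_top {x : E} (hx : SpansOverPowers p x) :
    Submodule.span (frobenius E p).fieldRange (Set.range fun i : Fin p => x ^ (i : ℕ)) = ⊤ := by
  refine eq_top_iff.2 fun z _ => ?_
  obtain ⟨a, rfl⟩ := hx z
  refine Submodule.sum_mem _ fun i hi => ?_
  have h1 : x ^ i * a i ^ p = (⟨a i ^ p, a i, rfl⟩ : (frobenius E p).fieldRange) • x ^ i := by
    rw [mul_comm]; rfl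
  rw [h1]
  exact Submodule.smul_mem _ _ (Submodule.subset_span ⟨⟨i, Finset.mem_range.1 hi⟩, rfl⟩)

theorem exists_eq_pow_coe (g : (frobenius E p).fieldRange) : ∃ a : E, a ^ p = g := by
  obtain ⟨a, ha⟩ := g.2
  exact ⟨a, ha⟩

theorem sum_smul_eq {x : E} (g : Fin p → (frobenius E p).fieldRange) (a : Fin p → E)
    (ha : ∀ i, a i ^ p = g i) : ∑ i, g i • x ^ (i : ℕ) =
      ∑ i ∈ Finset.range p, x ^ i * (fun i => if h : i < p then a ⟨i, h⟩ else 0) i ^ p := by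
  rw [Finset.sum_range]
  refine Finset.sum_congr rfl fun i _ => ?_
  simp only [Fin.is_lt, dite_true, Fin.eta]
  rw [ha, mul_comm]
  rfl

theorem IndepOverPowers.linearIndependent {x : E} (hx : IndepOverPowers p x) :
    LinearIndependent (frobenius E p).fieldRange fun i : Fin p => x ^ (i : ℕ) := by
  rw [Fintype.linearIndependent_iff]
  intro g hg i
  choose a ha using fun i => exists_eq_pow_coe (p := p) (g i)
  rw [sum_smul_eq g a ha] at hg
  have := hx _ hg i i.2
  simp only [Fin.is_lt, dite_true, Fin.eta] at this
  have h2 := ha i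
  rw [this, zero_pow (Fact.out : p.Prime).ne_zero] at h2
  exact Subtype.ext h2.symm

theorem IndepOverPowers.span_eq_top {x s : E} (hx : IndepOverPowers p x)
    (hs : SpansOverPowers p s) :
    Submodule.span (frobenius E p).fieldRange (Set.range fun i : Fin p => x ^ (i : ℕ)) = ⊤ := by
  have hfin : Module.Finite (frobenius E p).fieldRange E :=
    Module.finite_def.2 ⟨(Set.finite_range fun i : Fin p => s ^ (i : ℕ)).toFinset, by
      rw [Set.Finite.coe_toFinset]; exact hs.span_eq_top⟩
  apply hx.linearIndependent.span_eq_top_of_card_eq_finrank'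
  apply le_antisymm hx.linearIndependent.fintype_card_le_finrank
  exact finrank_le_of_span_eq_top hs.span_eq_top

theorem IndepOverPowers.spansOverPowers {x s : E} (hx : IndepOverPowers p x)
    (hs : SpansOverPowers p s) : SpansOverPowers p x := by
  intro z
  have hz : z ∈ Submodule.span (frobenius E p).fieldRange
    (Set.range fun i : Fin p => x ^ (i : ℕ)) := hx.span_eq_top hs ▸ Submodule.mem_top
  obtain ⟨g, rfl⟩ := (Submodule.mem_span_range_iff_exists_fun _).1 hz
  choose a ha using fun i => exists_eq_pow_coe (p := p) (g i)
  exact ⟨_, sum_smul_eq g a ha⟩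

/-- If `x` is a `p`-basis of `E` then there is a derivation `d / dx`. -/
theorem IndepOverPowers.exists_derivation {x : E} (hx : IndepOverPowers p x)
    (hs : SpansOverPowers p x) : ∃ D : Derivation ℤ E E, D x = 1 := by
  have hp : p.Prime := Fact.out
  let b := Module.Basis.mk hx.linearIndependent hs.span_eq_top.ge
  let D := b.constr (frobenius E p).fieldRange fun i : Fin p => ((i : ℕ) : E) * x ^ ((i : ℕ) - 1)
  have hDsmul (c z : E) : D (c ^ p * z) = c ^ p * D z :=
    D.map_smul (⟨c ^ p, c, rfl⟩ : (frobenius E p).fieldRange) z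
  have hDlow (i : ℕ) (hi : i < p) : D (x ^ i) = (i : E) * x ^ (i - 1) := by
    have h := b.constr_basis (frobenius E p).fieldRange
      (fun i : Fin p => ((i : ℕ) : E) * x ^ ((i : ℕ) - 1)) ⟨i, hi⟩
    rwa [Module.Basis.mk_apply] at h
  have hDpow (m : ℕ) : x * D (x ^ m) = (m : E) * x ^ m := by
    conv_lhs => rw [← Nat.div_add_mod m p, pow_add, mul_comm p, pow_mul, hDsmul,
      hDlow _ (Nat.mod_lt _ hp.pos)]
    conv_rhs => rw [← Nat.div_add_mod m p, pow_add, mul_comm p, pow_mul]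
    rcases Nat.eq_zero_or_pos (m % p) with h | h
    · simp [h]
    · obtain ⟨r, hr⟩ : ∃ r, m % p = r + 1 := ⟨m % p - 1, by omega⟩
      rw [hr]
      push_cast
      rw [CharP.cast_eq_zero E p]
      ring
  have hx0 : x ≠ 0 := by
    rintro rfl
    have := hx (fun i => if i = 1 then 1 else 0) (Finset.sum_eq_zero fun i _ => by
      rcases Nat.eq_zero_or_pos i with rfl | h
      · simp [hp.ne_zero]
      · simp [h.ne']) 1 hp.one_lt
    simp at this
  have hleib (y z : E) : D (y * z) = y * D z + z * D y := by
    obtain ⟨a, rfl⟩ := hs y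
    obtain ⟨a', rfl⟩ := hs z
    have hterm (i j : ℕ) : D ((x ^ i * a i ^ p) * (x ^ j * a' j ^ p)) =
        (x ^ i * a i ^ p) * D (x ^ j * a' j ^ p) + (x ^ j * a' j ^ p) * D (x ^ i * a i ^ p) := by
      rw [show (x ^ i * a i ^ p) * (x ^ j * a' j ^ p) = (a i * a' j) ^ p * x ^ (i + j) by ring,
        mul_comm (x ^ j), mul_comm (x ^ i), hDsmul, hDsmul, hDsmul]
      apply mul_left_cancel₀ hx0
      have h1 := hDpow (i + j)
      have h2 := hDpow i
      have h3 := hDpow j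
      push_cast at h1
      linear_combination (a i * a' j) ^ p * h1 - a i ^ p * x ^ i * a' j ^ p * h3 -
        a' j ^ p * x ^ j * a i ^ p * h2
    simp only [Finset.sum_mul_sum, map_sum, hterm, Finset.sum_add_distrib]
    congr 1
    rw [Finset.sum_comm]
  refine ⟨Derivation.mk' (D.toAddMonoidHom.toIntLinearMap) fun y z => hleib y z, ?_⟩
  have := hDpow 1
  rw [pow_one] at this
  apply mul_left_cancel₀ hx0
  change x * D x = x * 1
  simpa using this

end FrobeniusDigits

section IntegerValuation

variable {L : Type*} [Field L] (v : AddValuation L (WithTop ℤ))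

theorem exists_eq_coe {x : L} (hx : x ≠ 0) : ∃ m : ℤ, v x = m := by
  obtain ⟨m, hm⟩ := WithTop.ne_top_iff_exists.1 (fun h => hx (v.top_iff.1 h))
  exact ⟨m, hm.symm⟩

variable {v}

theorem ne_zero_of_eq_coe {x : L} {m : ℤ} (h : v x = m) : x ≠ 0 := by
  rintro rfl
  simp at h

theorem coe_le_mul {x y : L} {a b : ℤ} (hx : a ≤ v x) (hy : b ≤ v y) :
    ((a + b : ℤ) : WithTop ℤ) ≤ v (x * y) := by
  rw [v.map_mul, WithTop.coe_add]
  exact add_le_add hx hy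

theorem eq_coe_mul {x y : L} {a b : ℤ} (hx : v x = a) (hy : v y = b) :
    v (x * y) = ((a + b : ℤ) : WithTop ℤ) := by
  rw [v.map_mul, WithTop.coe_add, hx, hy]

theorem coe_le_pow {x : L} {a : ℤ} (hx : a ≤ v x) (n : ℕ) :
    ((n * a : ℤ) : WithTop ℤ) ≤ v (x ^ n) := by
  induction n with
  | zero => simp
  | succ n ih =>
    rw [pow_succ]
    convert coe_le_mul ih hx using 2
    push_cast
    ring

theorem eq_coe_pow {x : L} {a : ℤ} (hx : v x = a) (n : ℕ) :
    v (x ^ n) = ((n * a : ℤ) : WithTop ℤ) := by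
  induction n with
  | zero => simp
  | succ n ih =>
    rw [pow_succ, eq_coe_mul ih hx]
    congr 1
    push_cast
    ring

theorem eq_coe_inv {x : L} {a : ℤ} (hx : v x = a) : v x⁻¹ = ((-a : ℤ) : WithTop ℤ) := by
  have hx0 := ne_zero_of_eq_coe hx
  obtain ⟨b, hb⟩ := exists_eq_coe v (inv_ne_zero hx0)
  have h := eq_coe_mul hx hb
  rw [mul_inv_cancel₀ hx0, v.map_one] at h
  rw [hb]
  have : (0 : ℤ) = a + b := by exact_mod_cast h
  congr 1
  lia

theorem eq_coe_div {x y : L} {a b : ℤ} (hx : v x = a) (hy : v y = b) :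
    v (x / y) = ((a - b : ℤ) : WithTop ℤ) := by
  rw [div_eq_mul_inv, sub_eq_add_neg]
  exact eq_coe_mul hx (eq_coe_inv hy)

theorem coe_le_div {x y : L} {a b : ℤ} (hx : a ≤ v x) (hy : v y = b) :
    ((a - b : ℤ) : WithTop ℤ) ≤ v (x / y) := by
  rw [div_eq_mul_inv, sub_eq_add_neg]
  exact coe_le_mul hx (eq_coe_inv hy).ge

theorem eq_coe_zpow {x : L} {a : ℤ} (hx : v x = a) (n : ℤ) :
    v (x ^ n) = ((n * a : ℤ) : WithTop ℤ) := by
  obtain ⟨m, rfl | rfl⟩ := n.eq_nat_or_neg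
  · rw [zpow_natCast]
    exact eq_coe_pow hx m
  · rw [zpow_neg, zpow_natCast, eq_coe_inv (eq_coe_pow hx m), neg_mul]

/-- The valuation of `x` is determined by that of `x ^ n`. -/
theorem eq_coe_of_pow {x : L} {m b : ℤ} {n : ℕ} (hn : n ≠ 0)
    (h : v (x ^ n) = m) (hm : m = n * b) : v x = b := by
  have hx : x ≠ 0 := by
    rintro rfl
    rw [zero_pow hn] at h
    exact ne_zero_of_eq_coe h rfl
  obtain ⟨a, ha⟩ := exists_eq_coe v hx
  rw [eq_coe_pow ha, hm] at h
  have h1 : (n : ℤ) * a = n * b := by exact_mod_cast h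
  rw [ha, mul_left_cancel₀ (by exact_mod_cast hn) h1]

theorem coe_le_of_pow {x : L} {m b : ℤ} {n : ℕ} (hn : 0 < n)
    (h : m ≤ v (x ^ n)) (hm : n * (b - 1) < m) : b ≤ v x := by
  rcases eq_or_ne x 0 with rfl | hx
  · simp
  obtain ⟨a, ha⟩ := exists_eq_coe v hx
  rw [eq_coe_pow ha] at h
  have h1 : m ≤ n * a := by exact_mod_cast h
  rw [ha]
  have h2 : (n : ℤ) * (b - 1) < n * a := by lia
  have h3 := lt_of_mul_lt_mul_left h2 (by positivity)
  have h4 : b ≤ a := by lia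
  exact_mod_cast h4

theorem coe_le_sub {x y : L} {a : WithTop ℤ} (hx : a ≤ v x) (hy : a ≤ v y) : a ≤ v (x - y) := by
  rw [sub_eq_add_neg]
  exact v.map_le_add hx (by rwa [v.map_neg])

theorem eq_coe_add_of_lt {x y : L} {a b : ℤ} (hx : v x = a) (hy : b ≤ v y) (hab : a < b) :
    v (x + y) = a := by
  rw [← hx]
  refine v.map_add_eq_of_lt_left (lt_of_lt_of_le ?_ hy)
  rw [hx]
  exact_mod_cast hab

/-- A sum of terms of pairwise distinct valuations has the valuation of one of them, and this is
minimal. -/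
theorem exists_map_sum_eq {ι : Type*} {s : Finset ι} (hs : s.Nonempty) (f : ι → L)
    (hf : ∀ i ∈ s, ∀ j ∈ s, i ≠ j → f i ≠ 0 → f j ≠ 0 → v (f i) ≠ v (f j)) :
    ∃ i ∈ s, v (∑ i ∈ s, f i) = v (f i) ∧ ∀ j ∈ s, v (f i) ≤ v (f j) := by
  classical
  obtain ⟨i, hi, hmin⟩ := s.exists_min_image (fun i => v (f i)) hs
  refine ⟨i, hi, ?_, hmin⟩
  by_cases h0 : f i = 0
  · rw [Finset.sum_eq_zero, h0]
    intro j hj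
    have := hmin j hj
    rw [h0, v.map_zero, top_le_iff] at this
    exact v.top_iff.1 this
  rw [← Finset.add_sum_erase s f hi]
  apply v.map_add_eq_of_lt_left
  apply v.map_lt_sum (fun h => h0 (v.top_iff.1 h))
  intro j hj
  refine lt_of_le_of_ne (hmin j (Finset.mem_of_mem_erase hj)) ?_
  by_cases hj0 : f j = 0
  · rw [hj0, v.map_zero]
    exact fun h => h0 (v.top_iff.1 h)
  · exact hf i hi j (Finset.mem_of_mem_erase hj) (Finset.ne_of_mem_erase hj).symm h0 hj0

variable {p : ℕ} [hp : Fact p.Prime]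

/-- The terms `x ^ i aᵢ` have distinct valuations if `v x` is prime to `p` and `p ∣ v aᵢ`, relative
to some unit `e`. -/
theorem exists_map_sum_pow_mul_eq {x : L} {e m : ℤ} (he : e ≠ 0) (hm : ¬ (p : ℤ) ∣ m)
    (hx : v x = (e * m : ℤ)) {a : ℕ → L}
    (ha : ∀ i, a i ≠ 0 → ∃ k : ℤ, v (a i) = (e * (p * k) : ℤ)) :
    ∃ i < p, v (∑ i ∈ Finset.range p, x ^ i * a i) = v (x ^ i * a i) ∧
      ∀ j < p, v (x ^ i * a i) ≤ v (x ^ j * a j) := by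
  have := exists_map_sum_eq (v := v) (s := Finset.range p)
    (Finset.nonempty_range_iff.2 hp.out.ne_zero) (fun i => x ^ i * a i) ?_
  · simpa only [Finset.mem_range] using this
  intro i hi j hj hij hi0 hj0 h
  obtain ⟨k, hk⟩ := ha i (right_ne_zero_of_mul hi0)
  obtain ⟨l, hl⟩ := ha j (right_ne_zero_of_mul hj0)
  rw [eq_coe_mul (eq_coe_pow hx i) hk, eq_coe_mul (eq_coe_pow hx j) hl] at h
  have h1 : i * (e * m) + e * (p * k) = j * (e * m) + e * (p * l) := by exact_mod_cast h
  have h2 : e * (((i : ℤ) - j) * m) = e * (p * (l - k)) := by linear_combination h1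
  have h3 : (p : ℤ) ∣ ((i : ℤ) - j) * m := ⟨l - k, mul_left_cancel₀ he h2⟩
  have h4 := ((Nat.prime_iff_prime_int.1 hp.out).dvd_or_dvd h3).resolve_right hm
  have hi' := Finset.mem_range.1 hi
  have hj' := Finset.mem_range.1 hj
  have h5 := Int.eq_zero_of_abs_lt_dvd h4 (by rw [abs_lt]; constructor <;> lia)
  lia

theorem map_natCast_eq_zero [CharP L p] {i : ℕ} (h0 : 0 < i) (hi : i < p) : v (i : L) = 0 := by
  have h1 : ((i : ZMod p) : ZMod p) ^ (p - 1) = 1 := by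
    apply ZMod.pow_card_sub_one_eq_one
    rw [Ne, ZMod.natCast_eq_zero_iff]
    exact Nat.not_dvd_of_pos_of_lt h0 hi
  have h2 : (i : L) ^ (p - 1) = 1 := by
    have := congrArg (ZMod.castHom dvd_rfl L) h1
    simpa using this
  have h3 : v (1 : L) = ((0 : ℤ) : WithTop ℤ) := v.map_one
  have hp1 : p - 1 ≠ 0 := by have := hp.out.two_le; lia
  simpa using eq_coe_of_pow (b := 0) hp1 (h2 ▸ h3) (by simp)

theorem zero_le_map_natCast [CharP L p] (i : ℕ) : ((0 : ℤ) : WithTop ℤ) ≤ v (i : L) := by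
  induction i with
  | zero => simp
  | succ i ih =>
    rw [Nat.cast_succ]
    exact v.map_le_add ih v.map_one.ge

end IntegerValuation

section Stage

variable {p : ℕ} [hp : Fact p.Prime] {K L : Type*} [Field K] [Field L] [Algebra K L]

theorem derivation_pow_char [CharP L p] (D : Derivation ℤ L L) (a : L) : D (a ^ p) = 0 := by
  rw [D.leibniz_pow, ← Nat.cast_smul_eq_nsmul L, CharP.cast_eq_zero, zero_smul]

theorem derivation_mul_pow_char [CharP L p] (D : Derivation ℤ L L) (a b : L) :
    D (a * b ^ p) = D a * b ^ p := by
  rw [D.leibniz, derivation_pow_char, smul_zero, zero_add, smul_eq_mul, mul_comm]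

theorem mul_derivation_pow (D : Derivation ℤ L L) (x : L) (i : ℕ) :
    x * D (x ^ i) = i * x ^ i * D x := by
  rw [D.leibniz_pow, nsmul_eq_mul, smul_eq_mul]
  rcases i with _ | i
  · simp
  · rw [Nat.add_sub_cancel]
    ring

/-- `E` is an intermediate field on which `v` has value group `eℤ`, with uniformizer `τ` which is
a `p`-basis of `E`. -/
structure IsStage (p : ℕ) (v : AddValuation L (WithTop ℤ)) (E : IntermediateField K L) (e : ℤ)
    (τ : L) : Prop where
  pos : 0 < e
  mem : τ ∈ E
  val : v τ = e
  index : ∀ x ∈ E, x ≠ 0 → ∃ k : ℤ, v x = (e * k : ℤ)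
  digits : ∀ x ∈ E, ∃ a : ℕ → L, (∀ i, a i ∈ E) ∧ x = ∑ i ∈ Finset.range p, τ ^ i * a i ^ p

namespace IsStage

variable {v : AddValuation L (WithTop ℤ)} {E : IntermediateField K L} {e : ℤ} {τ : L}

theorem not_dvd_one : ¬ (p : ℤ) ∣ 1 := by
  intro h
  have h1 := Int.le_of_dvd one_pos h
  have := hp.out.two_le
  lia

theorem map_pow_eq (h : IsStage p v E e τ) {a : L} (ha : a ∈ E) (h0 : a ^ p ≠ 0) :
    ∃ k : ℤ, v (a ^ p) = (e * (p * k) : ℤ) := by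
  obtain ⟨k, hk⟩ := h.index a ha fun h => h0 (by rw [h, zero_pow hp.out.ne_zero])
  refine ⟨k, ?_⟩
  rw [eq_coe_pow hk]
  congr 1
  ring

theorem exists_digits (h : IsStage p v E e τ) {x : L} (hx : x ∈ E) :
    ∃ a : ℕ → L, (∀ i, a i ∈ E) ∧ x = ∑ i ∈ Finset.range p, τ ^ i * a i ^ p ∧
      ∀ i < p, v x ≤ v (τ ^ i * a i ^ p) := by
  obtain ⟨a, ha, rfl⟩ := h.digits x hx
  refine ⟨a, ha, rfl, ?_⟩
  have hτ : v τ = (e * 1 : ℤ) := by rw [mul_one]; exact h.val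
  obtain ⟨i, hi, h1, h2⟩ := exists_map_sum_pow_mul_eq h.pos.ne' (not_dvd_one (p := p)) hτ
    (a := fun i => a i ^ p) fun i h0 => h.map_pow_eq (ha i) h0
  intro j hj
  rw [h1]
  exact h2 j hj

theorem map_digit_nonneg (h : IsStage p v E e τ) {a : L} (ha : a ∈ E) {i : ℕ} (hi : i < p)
    (h0 : ((0 : ℤ) : WithTop ℤ) ≤ v (τ ^ i * a ^ p)) : ((0 : ℤ) : WithTop ℤ) ≤ v a := by
  rcases eq_or_ne a 0 with rfl | ha0
  · simp
  obtain ⟨k, hk⟩ := h.index a ha ha0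
  rw [eq_coe_mul (eq_coe_pow h.val i) (eq_coe_pow hk p)] at h0
  have h1 : 0 ≤ i * e + p * (e * k) := by exact_mod_cast h0
  have h2 : 0 ≤ e * (i + p * k) := by linarith
  have h3 : 0 ≤ (i + p * k : ℤ) := nonneg_of_mul_nonneg_right h2 h.pos
  have h4 : 0 ≤ k := by
    by_contra hk
    have : (p : ℤ) * k ≤ p * (-1) := mul_le_mul_of_nonneg_left (by lia) (by positivity)
    lia
  rw [hk]
  have := mul_nonneg h.pos.le h4
  exact_mod_cast this

variable [CharP L p] {D : Derivation ℤ L L} {c : ℤ}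

theorem mul_derivation_sum (a : ℕ → L) :
    τ * D (∑ i ∈ Finset.range p, τ ^ i * a i ^ p) =
      (∑ i ∈ Finset.range p, τ ^ i * (i * a i ^ p)) * D τ := by
  rw [map_sum, Finset.mul_sum, Finset.sum_mul]
  refine Finset.sum_congr rfl fun i _ => ?_
  rw [derivation_mul_pow_char, ← mul_assoc, mul_derivation_pow]
  ring

theorem coe_le_sum_digits {m : WithTop ℤ} {a : ℕ → L}
    (ha : ∀ i < p, m ≤ v (τ ^ i * a i ^ p)) :
    m ≤ v (∑ i ∈ Finset.range p, τ ^ i * (i * a i ^ p)) := by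
  apply v.map_le_sum
  intro i hi
  rw [mul_left_comm, v.map_mul]
  have := add_le_add (zero_le_map_natCast (v := v) (p := p) i) (ha i (Finset.mem_range.1 hi))
  simpa using this

theorem le_map_derivation (h : IsStage p v E e τ) (hD : v (D τ) = (e - c : ℤ)) {x : L}
    (hx : x ∈ E) {m : ℤ} (hm : m ≤ v x) : ((m - c : ℤ) : WithTop ℤ) ≤ v (D x) := by
  obtain ⟨a, ha, rfl, hv⟩ := h.exists_digits hx
  have h1 : m ≤ v (∑ i ∈ Finset.range p, τ ^ i * (i * a i ^ p)) :=
    coe_le_sum_digits fun i hi => hm.trans (hv i hi)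
  have h2 := coe_le_div (coe_le_mul h1 hD.ge) h.val
  rw [← mul_derivation_sum, mul_div_cancel_left₀ _ (ne_zero_of_eq_coe h.val)] at h2
  convert h2 using 2
  ring

theorem map_derivation_eq (h : IsStage p v E e τ) (hD : v (D τ) = (e - c : ℤ)) {x : L}
    (hx : x ∈ E) {m : ℤ} (hm : ¬ (p : ℤ) ∣ m) (hxm : v x = (e * m : ℤ)) :
    v (D x) = (e * m - c : ℤ) := by
  obtain ⟨a, ha, rfl, -⟩ := h.exists_digits hx
  have hτ : v τ = (e * 1 : ℤ) := by rw [mul_one]; exact h.val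
  obtain ⟨i, hi, h1, h2⟩ := exists_map_sum_pow_mul_eq h.pos.ne' (not_dvd_one (p := p)) hτ
    (a := fun i => a i ^ p) fun i h0 => h.map_pow_eq (ha i) h0
  have hi0 : 0 < i := by
    by_contra h0
    obtain rfl : i = 0 := by lia
    rw [hxm, pow_zero, one_mul] at h1
    obtain ⟨k, hk⟩ := h.map_pow_eq (ha 0) (ne_zero_of_eq_coe h1.symm)
    rw [hk] at h1
    have h3 : e * m = e * (p * k) := by exact_mod_cast h1
    exact hm ⟨k, mul_left_cancel₀ h.pos.ne' h3⟩
  have hnat (j : ℕ) (hj : (j : L) * a j ^ p ≠ 0) : v (j : L) = 0 ∨ p ≤ j := by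
    rcases lt_or_ge j p with hjp | hjp
    · refine Or.inl (map_natCast_eq_zero (Nat.pos_of_ne_zero ?_) hjp)
      rintro rfl
      simp at hj
    · exact Or.inr hjp
  obtain ⟨l, hl, h3, h4⟩ := exists_map_sum_pow_mul_eq h.pos.ne' (not_dvd_one (p := p)) hτ
    (a := fun i => if i < p then (i : L) * a i ^ p else 0) fun j h0 => by
      have hjp : j < p := by
        by_contra hh
        simp [hh] at h0
      simp only [hjp, if_true] at h0 ⊢
      obtain ⟨k, hk⟩ := h.map_pow_eq (ha j) (right_ne_zero_of_mul h0)
      refine ⟨k, ?_⟩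
      rw [v.map_mul, (hnat j h0).resolve_right (by lia), hk, zero_add]
  have h5 : v (∑ i ∈ Finset.range p, τ ^ i * (i * a i ^ p)) = (e * m : ℤ) := by
    apply le_antisymm
    · rw [show ∑ i ∈ Finset.range p, τ ^ i * (i * a i ^ p) = ∑ i ∈ Finset.range p, τ ^ i *
        (fun i => if i < p then (i : L) * a i ^ p else 0) i from
        Finset.sum_congr rfl fun i hi => by simp [Finset.mem_range.1 hi], h3]
      refine (h4 i hi).trans ?_
      simp only [hi, if_true]
      rw [mul_left_comm, v.map_mul, map_natCast_eq_zero hi0 hi, zero_add, ← h1, hxm]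
    · apply coe_le_sum_digits
      intro j hj
      rw [← hxm, h1]
      exact h2 j hj
  have h6 := eq_coe_div (eq_coe_mul h5 hD) h.val
  rw [← mul_derivation_sum, mul_div_cancel_left₀ _ (ne_zero_of_eq_coe h.val)] at h6
  rw [h6]
  congr 1
  ring

theorem exists_derivation_eq_mul (h : IsStage p v E e τ) {x : L}
    (hx : x ∈ E) (h0 : ((0 : ℤ) : WithTop ℤ) ≤ v x) :
    ∃ q : L, ((0 : ℤ) : WithTop ℤ) ≤ v q ∧ D x = q * D τ := by
  obtain ⟨a, ha, rfl, hv⟩ := h.exists_digits hx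
  refine ⟨∑ i ∈ Finset.range p, i * τ ^ (i - 1) * a i ^ p, ?_, ?_⟩
  · apply v.map_le_sum
    intro i hi
    have hi := Finset.mem_range.1 hi
    have h1 := h.map_digit_nonneg (ha i) hi (h0.trans (hv i hi))
    have hτ : ((0 : ℤ) : WithTop ℤ) ≤ v τ := by
      rw [h.val]
      exact_mod_cast h.pos.le
    simpa using coe_le_mul (coe_le_mul (zero_le_map_natCast (v := v) (p := p) i)
      (coe_le_pow hτ (i - 1))) (coe_le_pow h1 p)
  · rw [map_sum, Finset.sum_mul]
    refine Finset.sum_congr rfl fun i _ => ?_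
    rw [derivation_mul_pow_char, D.leibniz_pow, nsmul_eq_mul, smul_eq_mul]
    ring

theorem exists_add_derivation (h : IsStage p v E e τ) {z : L} (hz : z ∈ E) {m : ℤ}
    (hm : m ≤ v z) : ∃ b ∈ E, ∃ f ∈ E, z * D τ = τ ^ (p - 1) * b ^ p * D τ + D f ∧
      ((m + e : ℤ) : WithTop ℤ) ≤ v f := by
  obtain ⟨a, ha, rfl, hv⟩ := h.exists_digits hz
  obtain ⟨q, hq⟩ : ∃ q, p = q + 1 := ⟨p - 1, by have := hp.out.pos; lia⟩
  have hcast (i : ℕ) (hi : i < q) : v ((i + 1 : ℕ) : L) = ((0 : ℤ) : WithTop ℤ) :=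
    map_natCast_eq_zero (p := p) (by lia) (by lia)
  refine ⟨a q, ha q, ∑ i ∈ Finset.range q, τ ^ (i + 1) * a i ^ p / ((i + 1 : ℕ) : L), ?_, ?_, ?_⟩
  · exact sum_mem fun i _ => div_mem (mul_mem (pow_mem h.mem _) (pow_mem (ha i) _))
      (natCast_mem _ _)
  · have : Finset.range p = Finset.range (q + 1) := by rw [hq]
    rw [this, Finset.sum_range_succ, add_mul, add_comm, show p - 1 = q by lia, map_sum,
      Finset.sum_mul]
    congr 1
    refine Finset.sum_congr rfl fun i hi => ?_
    have h0 := ne_zero_of_eq_coe (hcast i (Finset.mem_range.1 hi))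
    have h1 : (((i + 1 : ℕ) : L)⁻¹) = (((i + 1 : ℕ) : L)⁻¹) ^ p := by
      rw [inv_pow, ← frobenius_def, map_natCast]
    rw [div_eq_mul_inv, h1, derivation_mul_pow_char, derivation_mul_pow_char, ← h1,
      D.leibniz_pow, Nat.add_sub_cancel, nsmul_eq_mul, smul_eq_mul]
    field_simp
  · apply v.map_le_sum
    intro i hi
    have hi := Finset.mem_range.1 hi
    have h1 := coe_le_div (coe_le_mul (hm.trans (hv i (by lia))) h.val.ge) (hcast i hi)
    rw [sub_zero] at h1
    convert h1 using 3
    ring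

theorem eq_zero_of_eq_derivation (h : IsStage p v E e τ) (hD : D τ ≠ 0) {b f : L} (hb : b ∈ E)
    (hf : f ∈ E) (hbf : τ ^ (p - 1) * b ^ p * D τ = D f) : b = 0 := by
  obtain ⟨a, ha, rfl⟩ := h.digits f hf
  obtain ⟨q, hq⟩ : ∃ q, p = q + 1 := ⟨p - 1, by have := hp.out.pos; lia⟩
  have h1 : τ ^ p * b ^ p = ∑ i ∈ Finset.range p, τ ^ i * (i * a i ^ p) := by
    apply mul_right_cancel₀ hD
    rw [← mul_derivation_sum, ← hbf]
    have : τ ^ p = τ * τ ^ (p - 1) := by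
      rw [← pow_succ', Nat.sub_add_cancel hp.out.pos]
    rw [this]
    ring
  have hτ : v τ = (e * 1 : ℤ) := by rw [mul_one]; exact h.val
  have hτb : τ * b ∈ E := mul_mem h.mem hb
  obtain ⟨l, hl, h3, h4⟩ := exists_map_sum_pow_mul_eq h.pos.ne' (not_dvd_one (p := p)) hτ
    (a := fun i => if i = 0 then (-(τ * b)) ^ p else if i < p then (i : L) * a i ^ p else 0)
    fun j h0 => by
      by_cases hj0 : j = 0
      · simp only [hj0, if_true] at h0 ⊢
        exact h.map_pow_eq (neg_mem hτb) h0
      have hjp : j < p := by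
        by_contra hh
        simp [hh, hj0] at h0
      simp only [hjp, hj0, if_true, if_false] at h0 ⊢
      obtain ⟨k, hk⟩ := h.map_pow_eq (ha j) (right_ne_zero_of_mul h0)
      refine ⟨k, ?_⟩
      rw [v.map_mul, map_natCast_eq_zero (Nat.pos_of_ne_zero hj0) hjp, hk, zero_add]
  have h5 : ∑ i ∈ Finset.range p, τ ^ i *
      (fun i => if i = 0 then (-(τ * b)) ^ p else if i < p then (i : L) * a i ^ p else 0) i
      = 0 := by
    have hr : Finset.range p = Finset.range (q + 1) := by rw [hq]
    have hneg : (-(τ * b)) ^ p = - (τ ^ p * b ^ p) := by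
      rw [← mul_pow, ← frobenius_def, ← frobenius_def, map_neg]
    rw [hr, Finset.sum_range_succ'] at h1 ⊢
    simp only [pow_zero, if_true, hneg, h1]
    rw [Nat.cast_zero, one_mul, one_mul, zero_mul, add_zero, ← sub_eq_add_neg, sub_eq_zero]
    refine Finset.sum_congr rfl fun i hi => ?_
    have hi := Finset.mem_range.1 hi
    simp [show i + 1 < p by lia]
  rw [h5, v.map_zero] at h3
  have h6 := h4 0 hp.out.pos
  rw [← h3, top_le_iff, v.top_iff] at h6
  simp only [pow_zero, if_true, one_mul] at h6
  have h7 := eq_zero_of_pow_eq_zero h6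
  rw [neg_eq_zero] at h7
  exact (mul_eq_zero.1 h7).resolve_left (ne_zero_of_eq_coe h.val)

theorem exists_cartier (h : IsStage p v E e τ) (hD : D τ ≠ 0) {y : L} (hy : y ∈ E) :
    ∃ f ∈ E, y ^ (p - 1) * D y = τ ^ (p - 1) * (D y / D τ) ^ p * D τ + D f := by
  obtain ⟨a, ha, rfl⟩ := h.digits y hy
  obtain ⟨q, hq⟩ : ∃ q, p = q + 1 := ⟨p - 1, by have := hp.out.pos; lia⟩
  have hpq : p - 1 = q := by lia
  have key : ∀ s : Finset ℕ, ∑ i ∈ s, τ ^ i * a i ^ p ∈ E ∧ ∃ f ∈ E,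
      (∑ i ∈ s, τ ^ i * a i ^ p) ^ (p - 1) * D (∑ i ∈ s, τ ^ i * a i ^ p) =
        τ ^ (p - 1) * (D (∑ i ∈ s, τ ^ i * a i ^ p) / D τ) ^ p * D τ + D f := by
    intro s
    induction s using Finset.induction_on with
    | empty =>
      refine ⟨by simp, 0, zero_mem _, ?_⟩
      simp [hp.out.ne_zero]
    | insert j s hj ih =>
      rw [Finset.sum_insert hj]
      obtain ⟨hx, f, hf, hxf⟩ := ih
      set x := ∑ i ∈ s, τ ^ i * a i ^ p
      have hy : τ ^ j * a j ^ p ∈ E := mul_mem (pow_mem h.mem _) (pow_mem (ha j) _)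
      have hyf : (τ ^ j * a j ^ p) ^ (p - 1) * D (τ ^ j * a j ^ p) =
          τ ^ (p - 1) * (D (τ ^ j * a j ^ p) / D τ) ^ p * D τ := by
        rw [derivation_mul_pow_char, D.leibniz_pow, nsmul_eq_mul, smul_eq_mul]
        rw [show (j * (τ ^ (j - 1) * D τ)) * a j ^ p / D τ = j * (τ ^ (j - 1) * a j ^ p) by
          field_simp, mul_pow (j : L), ← frobenius_def p (j : L), map_natCast, hpq]
        rcases j with _ | j
        · simp
        · rw [Nat.add_sub_cancel, mul_pow, hq]
          ring
      set y := τ ^ j * a j ^ p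
      have hadd := WittVector.sum_pow_smul_derivation_add D (WittVector.teichmuller p y)
        (WittVector.teichmuller p x) 1
      simp only [Finset.sum_range_succ, Finset.sum_range_zero, zero_add,
        WittVector.add_coeff_zero, WittVector.teichmuller_coeff_zero,
        WittVector.teichmuller_coeff_pos _ _ _ one_pos, Nat.sub_zero, pow_one, smul_eq_mul,
        map_zero, mul_zero, add_zero, Nat.sub_self, pow_zero, one_mul] at hadd
      have hmem (z : L) (hz : z ∈ E) (i : ℕ) :
          (WittVector.teichmuller p z).coeff i ∈ E.toSubfield.toSubring := by
        rcases Nat.eq_zero_or_pos i with rfl | hi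
        · rw [WittVector.teichmuller_coeff_zero]
          exact hz
        · rw [WittVector.teichmuller_coeff_pos _ _ _ hi]
          exact zero_mem _
      have hc := WittVector.coeff_add_mem E.toSubfield.toSubring (hmem y hy) (hmem x hx) 1
      refine ⟨add_mem hy hx, _, sub_mem hf hc, ?_⟩
      rw [map_sub, map_add, add_div, add_pow_char (p := p)]
      rw [hyf, hxf, map_add] at hadd
      linear_combination hadd
  exact (key _).2

theorem exists_sum_cartier (h : IsStage p v E e τ) (hD : D τ ≠ 0) (s : Finset ℕ) {y g : ℕ → L}
    (hy : ∀ i ∈ s, y i ∈ E) (hg : ∀ i ∈ s, g i ∈ E) :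
    ∃ f ∈ E, ∑ i ∈ s, g i ^ p * y i ^ (p - 1) * D (y i) =
      τ ^ (p - 1) * ((∑ i ∈ s, g i * D (y i)) / D τ) ^ p * D τ + D f := by
  classical
  induction s using Finset.induction_on with
  | empty =>
    refine ⟨0, zero_mem _, ?_⟩
    simp [hp.out.ne_zero]
  | insert j s hj ih =>
    obtain ⟨f, hf, hsf⟩ := ih (fun i hi => hy i (Finset.mem_insert_of_mem hi))
      fun i hi => hg i (Finset.mem_insert_of_mem hi)
    obtain ⟨f', hf', hjf⟩ := h.exists_cartier hD (hy j (Finset.mem_insert_self _ _))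
    rw [Finset.sum_insert hj, Finset.sum_insert hj]
    refine ⟨f' * g j ^ p + f, add_mem (mul_mem hf' (pow_mem (hg j (Finset.mem_insert_self _ _)) _))
      hf, ?_⟩
    rw [hsf, map_add, derivation_mul_pow_char, add_div, add_pow_char,
      mul_assoc, hjf, mul_div_assoc, mul_pow]
    ring

/-- Artin–Schreier reduction of `w` when the derivative of `w` is known up to exact terms. -/
theorem exists_reduction (h : IsStage p v E e τ) (hD : v (D τ) = (e - c : ℤ)) {w η b f : L}
    (hw : w ∈ E) (hf : f ∈ E) (hDw : D w = η + (τ ^ (p - 1) * b ^ p * D τ + D f))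
    {A B B₀ : ℤ} (hA : v η = (-A : ℤ))
    (hb : ((-A + 1 : ℤ) : WithTop ℤ) ≤ v (τ ^ (p - 1) * b ^ p * D τ))
    (hwB : ((-B : ℤ) : WithTop ℤ) ≤ v w) (hfB : ((-B₀ : ℤ) : WithTop ℤ) ≤ v f)
    (hB₀ : 0 ≤ B₀) (hBB : p * B₀ ≤ B) (hBA : B < p * (A - c)) :
    ∃ g ∈ E, v (w - (g ^ p - g)) = (-(A - c) : ℤ) ∧ ∃ m, A - c = e * m ∧ ¬ (p : ℤ) ∣ m := by
  have hp0 : (1 : ℤ) ≤ p := by exact_mod_cast hp.out.pos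
  set w' := w - ((-f) ^ p - (-f)) with hw'
  have hw'E : w' ∈ E := sub_mem hw (sub_mem (pow_mem (neg_mem hf) _) (neg_mem hf))
  have hDw' : v (D w') = (-A : ℤ) := by
    have : D w' = η + τ ^ (p - 1) * b ^ p * D τ := by
      rw [hw', map_sub, map_sub, derivation_pow_char, hDw, map_neg]
      ring
    rw [this]
    exact eq_coe_add_of_lt hA hb (by lia)
  have hfB' : ((-B₀ : ℤ) : WithTop ℤ) ≤ v (-f) := by rwa [v.map_neg]
  have hw'B : ((-B : ℤ) : WithTop ℤ) ≤ v w' := by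
    refine coe_le_sub hwB (coe_le_sub (le_trans ?_ (coe_le_pow hfB' p)) (le_trans ?_ hfB'))
    · norm_cast
      linarith
    · norm_cast
      nlinarith
  obtain ⟨a, ha, hsum, hv⟩ := h.exists_digits hw'E
  have hτ : v τ = (e * 1 : ℤ) := by rw [mul_one]; exact h.val
  obtain ⟨i, hi, h1, -⟩ := exists_map_sum_pow_mul_eq h.pos.ne' (not_dvd_one (p := p)) hτ
    (a := fun i => if i = 0 then 0 else a i ^ p) fun j h0 => by
      by_cases hj0 : j = 0
      · simp [hj0] at h0
      simp only [hj0, if_false] at h0 ⊢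
      exact h.map_pow_eq (ha j) h0
  set r := ∑ i ∈ Finset.range p, τ ^ i * (fun i => if i = 0 then 0 else a i ^ p) i with hr
  have hrE : r ∈ E := sum_mem fun i _ => mul_mem (pow_mem h.mem _) (by
    dsimp only
    split_ifs
    exacts [zero_mem _, pow_mem (ha i) _])
  have hw'r : w' = r + a 0 ^ p := by
    obtain ⟨q, hq⟩ : ∃ q, p = q + 1 := ⟨p - 1, by have := hp.out.pos; lia⟩
    have hpq : Finset.range p = Finset.range (q + 1) := by rw [hq]
    rw [hsum, hr, hpq, Finset.sum_range_succ', Finset.sum_range_succ']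
    simp
  have hDr : v (D r) = (-A : ℤ) := by
    rw [← hDw', hw'r, map_add, derivation_pow_char, add_zero]
  have hr0 : r ≠ 0 := by
    intro h0
    rw [h0, map_zero] at hDr
    exact ne_zero_of_eq_coe hDr rfl
  have hi0 : i ≠ 0 := by
    rintro rfl
    simp only [if_true, mul_zero, v.map_zero, v.top_iff] at h1
    exact hr0 h1
  simp only [hi0, if_false] at h1
  have hai : a i ^ p ≠ 0 := by
    intro h0
    rw [h0, mul_zero, v.map_zero, v.top_iff] at h1
    exact hr0 h1
  obtain ⟨k, hk⟩ := h.map_pow_eq (ha i) hai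
  rw [eq_coe_mul (eq_coe_pow h.val i) hk] at h1
  have hrv : v r = (e * (i + p * k) : ℤ) := by
    rw [h1]
    congr 1
    ring
  have hdvd : ¬ (p : ℤ) ∣ i + p * k := by
    intro hh
    have := (Int.dvd_add_left (dvd_mul_right (p : ℤ) k)).1 hh
    exact Nat.not_dvd_of_pos_of_lt (Nat.pos_of_ne_zero hi0) hi (by exact_mod_cast this)
  have hAc : e * (i + p * k) - c = -A := by
    have := h.map_derivation_eq hD hrE hdvd hrv
    rw [hDr] at this
    exact_mod_cast this.symm
  refine ⟨-f + a 0, add_mem (neg_mem hf) (ha 0), ?_, -(i + p * k), by linarith, by rwa [dvd_neg]⟩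
  have : w - ((-f + a 0) ^ p - (-f + a 0)) = r + a 0 := by
    rw [add_pow_char]
    linear_combination hw'r - hw'
  rw [this]
  apply eq_coe_add_of_lt (b := -(A - c) + 1)
  · rw [hrv]
    congr 1
    linarith
  · apply coe_le_of_pow (n := p) hp.out.pos (m := -B)
    · have := hw'B.trans (hv 0 hp.out.pos)
      rwa [pow_zero, one_mul] at this
    · linarith
  · lia

end IsStage

end Stage

section StageStep

variable {p : ℕ} [hp : Fact p.Prime] {K L : Type*} [Field K] [Field L] [Algebra K L]
  {v : AddValuation L (WithTop ℤ)} {E : IntermediateField K L} {e : ℤ} {τ s : L}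

theorem indepOverPowers_of_index [CharP L p] (pos : 0 < e) (val : v τ = e)
    (index : ∀ x, x ≠ 0 → ∃ k : ℤ, v x = (e * k : ℤ)) : IndepOverPowers p τ := by
  intro a h0 i hi
  have hτ : v τ = (e * 1 : ℤ) := by rw [mul_one]; exact val
  obtain ⟨l, hl, h1, h2⟩ := exists_map_sum_pow_mul_eq pos.ne' (IsStage.not_dvd_one (p := p)) hτ
    (a := fun i => a i ^ p) fun i h0 => by
      obtain ⟨k, hk⟩ := index (a i) (ne_zero_pow hp.out.ne_zero h0)
      refine ⟨k, ?_⟩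
      rw [eq_coe_pow hk]
      congr 1
      ring
  have h3 := h2 i hi
  rw [← h1, h0, v.map_zero, top_le_iff, v.top_iff] at h3
  exact eq_zero_of_pow_eq_zero
    ((mul_eq_zero.1 h3).resolve_left (pow_ne_zero _ (ne_zero_of_eq_coe val)))

theorem isStage_of_index [CharP L p] (hG : ∀ z ∈ E, ∃ a : ℕ → L, (∀ i, a i ∈ E) ∧
      z = ∑ i ∈ Finset.range p, s ^ i * a i ^ p) (hs : s ∈ E) (pos : 0 < e) (mem : τ ∈ E)
    (val : v τ = e) (index : ∀ x ∈ E, x ≠ 0 → ∃ k : ℤ, v x = (e * k : ℤ)) :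
    IsStage p v E e τ := by
  refine ⟨pos, mem, val, index, fun x hx => ?_⟩
  have : CharP E p := (algebraMap E L).charP (algebraMap E L).injective p
  have hsE : SpansOverPowers p (⟨s, hs⟩ : E) := by
    intro z
    obtain ⟨a, ha, hz⟩ := hG z z.2
    refine ⟨fun i => ⟨a i, ha i⟩, ?_⟩
    ext1
    rw [hz]
    simp
  have hτE : IndepOverPowers p (⟨τ, mem⟩ : E) :=
    indepOverPowers_of_index (v := v.comap (algebraMap E L)) pos val
      fun x hx => index x x.2 fun h => hx (Subtype.ext h)
  obtain ⟨a, ha⟩ := hτE.spansOverPowers hsE ⟨x, hx⟩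
  refine ⟨fun i => a i, fun i => (a i).2, ?_⟩
  have := congrArg (Subtype.val : E → L) ha
  simpa using this

theorem mem_adjoin_simple_artinSchreier {y r : L} (hr : r ∈ E) (hy : y ^ p - y = r) {z : L}
    (hz : z ∈ IntermediateField.adjoin E {y}) :
    ∃ b : ℕ → L, (∀ i, b i ∈ E) ∧ z = ∑ i ∈ Finset.range p, y ^ i * b i := by
  open Polynomial in
  let P : E[X] := X ^ p - (X + C ⟨r, hr⟩)
  have hdeg : (X + C ⟨r, hr⟩ : E[X]).degree < p := by
    rw [degree_X_add_C]
    exact_mod_cast hp.out.one_lt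
  have hmonic : P.Monic := monic_X_pow_sub hdeg
  have hP : P.degree = p := by
    rw [degree_sub_eq_left_of_degree_lt (by rwa [degree_X_pow]), degree_X_pow]
  have hroot : aeval y P = 0 := by
    simp only [P, map_sub, map_add, map_pow, aeval_X, aeval_C]
    rw [show algebraMap E L ⟨r, hr⟩ = r from rfl]
    linear_combination hy
  rw [← IntermediateField.mem_toSubalgebra,
    IntermediateField.adjoin_simple_toSubalgebra_of_isAlgebraic
      (IsIntegral.isAlgebraic ⟨P, hmonic, by simpa [aeval_def] using hroot⟩),
    Algebra.adjoin_singleton_eq_range_aeval] at hz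
  obtain ⟨Q, rfl⟩ := hz
  refine ⟨fun i => (Q %ₘ P).coeff i, fun i => Subtype.property _, ?_⟩
  have h1 : (Q %ₘ P).natDegree < p := by
    rcases eq_or_ne (Q %ₘ P) 0 with h | h
    · rw [h, natDegree_zero]
      exact hp.out.pos
    · rw [natDegree_lt_iff_degree_lt h, ← hP]
      exact degree_modByMonic_lt _ hmonic
  change aeval y Q = _
  rw [← aeval_modByMonic_eq_self_of_root hroot, aeval_eq_sum_range' h1]
  refine Finset.sum_congr rfl fun i _ => ?_
  rw [Algebra.smul_def, mul_comm]
  rfl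

/-- The valuation-theoretic invariants of a ramified Artin–Schreier extension of a stage. -/
theorem IsStage.exists_step [CharP L p] (h : IsStage p v E e τ) (hs : s ∈ E)
    (hG : ∀ F : IntermediateField K L, ∀ z ∈ F, ∃ a : ℕ → L, (∀ i, a i ∈ F) ∧
      z = ∑ i ∈ Finset.range p, s ^ i * a i ^ p) {D : Derivation ℤ L L} {y r : L} (hr : r ∈ E)
    (hy : y ^ p - y = r) {e' m A : ℤ} (he : e = p * e') (hm : ¬ (p : ℤ) ∣ m) (hm0 : 0 < e * m)
    (hrv : v r = (-(e * m) : ℤ)) (hDr : v (D r) = (-A : ℤ)) :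
    ∃ F : IntermediateField K L, E ≤ F ∧ y ∈ F ∧ ∃ τ', IsStage p v F e' τ' ∧
      v (D τ') = (e' - (A - e' * m) : ℤ) := by
  have hp1 : (1 : ℤ) < p := by exact_mod_cast hp.out.one_lt
  have he' : 0 < e' := by
    have := h.pos
    rw [he] at this
    exact (mul_pos_iff_of_pos_left (by lia)).1 this
  have hy0 : y ≠ 0 := by
    rintro rfl
    rw [zero_pow hp.out.ne_zero, sub_zero] at hy
    exact ne_zero_of_eq_coe hrv hy.symm
  have hyv : v y = (e' * (-m) : ℤ) := by
    obtain ⟨a, ha⟩ := exists_eq_coe v hy0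
    have ha0 : a < 0 := by
      by_contra! h0
      have h1 : ((0 : ℤ) : WithTop ℤ) ≤ v y := by rw [ha]; exact_mod_cast h0
      have h2 := coe_le_sub (by simpa only [mul_zero] using coe_le_pow h1 p) h1
      rw [hy, hrv] at h2
      have : 0 ≤ -(e * m) := by exact_mod_cast h2
      linarith
    have h1 : v (-y) = a := by rw [v.map_neg, ha]
    have h2 := eq_coe_add_of_lt (eq_coe_pow ha p) h1.ge (by nlinarith)
    rw [← sub_eq_add_neg, hy, hrv] at h2
    have h3 : -(e * m) = p * a := by exact_mod_cast h2
    rw [ha]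
    congr 1
    rw [he] at h3
    apply mul_left_cancel₀ (show (p : ℤ) ≠ 0 by lia)
    linarith
  have hm' : ¬ (p : ℤ) ∣ -m := by rwa [dvd_neg]
  let F : IntermediateField K L := (IntermediateField.adjoin E {y}).restrictScalars K
  have hEF : E ≤ F := fun x hx => (IntermediateField.adjoin E {y}).algebraMap_mem ⟨x, hx⟩
  have hyF : y ∈ F := IntermediateField.mem_adjoin_simple_self E y
  have hindex : ∀ x ∈ F, x ≠ 0 → ∃ k : ℤ, v x = (e' * k : ℤ) := by
    intro x hx hx0
    obtain ⟨b, hb, rfl⟩ := mem_adjoin_simple_artinSchreier hr hy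
      (IntermediateField.mem_restrictScalars K |>.1 hx)
    have hbi (i) (h0 : b i ≠ 0) : ∃ k : ℤ, v (b i) = (e' * (p * k) : ℤ) := by
      obtain ⟨k, hk⟩ := h.index (b i) (hb i) h0
      refine ⟨k, ?_⟩
      rw [hk, he]
      congr 1
      ring
    obtain ⟨i, hi, h1, -⟩ := exists_map_sum_pow_mul_eq he'.ne' hm' hyv hbi
    have hi0 : b i ≠ 0 := by
      intro h0
      rw [h0, mul_zero, v.map_zero, v.top_iff] at h1
      exact hx0 h1
    obtain ⟨k, hk⟩ := hbi i hi0
    refine ⟨i * (-m) + p * k, ?_⟩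
    rw [h1, eq_coe_mul (eq_coe_pow hyv i) hk]
    congr 1
    ring
  obtain ⟨a, b, hab⟩ : ∃ a b : ℤ, a * (-m) + b * p = 1 := by
    have := (((Nat.prime_iff_prime_int.1 hp.out).irreducible.coprime_iff_not_dvd).2 hm').symm
    exact this
  have hτ'v : v (y ^ a * τ ^ b) = (e' : ℤ) := by
    rw [eq_coe_mul (eq_coe_zpow hyv a) (eq_coe_zpow h.val b), he]
    congr 1
    linear_combination e' * hab
  have hF : IsStage p v F e' (y ^ a * τ ^ b) := isStage_of_index (hG F) (hEF hs) he'
    (mul_mem (zpow_mem hyF a) (zpow_mem (hEF h.mem) b)) hτ'v hindex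
  refine ⟨F, hEF, hyF, _, hF, ?_⟩
  have hDy : v (D y) = (-A : ℤ) := by
    rw [← hDr, ← hy, map_sub, derivation_pow_char, zero_sub, v.map_neg]
  have hDτ : D (y ^ a * τ ^ b) ≠ 0 := by
    intro h0
    obtain ⟨d, -, hd⟩ := hF.digits y hyF
    have h1 := IsStage.mul_derivation_sum (p := p) (D := D) (τ := y ^ a * τ ^ b) d
    rw [← hd, h0, mul_zero] at h1
    have := (mul_eq_zero.1 h1).resolve_left (ne_zero_of_eq_coe hτ'v)
    exact ne_zero_of_eq_coe hDy this
  obtain ⟨l, hl⟩ := exists_eq_coe v hDτ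
  have h1 := hF.map_derivation_eq (c := e' - l) (by rw [hl]; congr 1; ring) hyF hm' hyv
  rw [hDy] at h1
  have h2 : -A = e' * -m - (e' - l) := by exact_mod_cast h1
  rw [hl]
  congr 1
  linarith

end StageStep

section Laurent

variable {p : ℕ} [hp : Fact p.Prime]

theorem PowerSeries.exists_eq_sum_X_pow_mul_pow {k : Type*} [Field k] [CharP k p] [PerfectField k]
    (f : PowerSeries k) :
    ∃ a : ℕ → PowerSeries k, f = ∑ i ∈ Finset.range p, PowerSeries.X ^ i * a i ^ p := by
  have : PerfectRing k p := PerfectField.toPerfectRing p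
  have hpow (g : PowerSeries k) (n : ℕ) : PowerSeries.coeff n (g ^ p) =
      if p ∣ n then (PowerSeries.coeff (n / p) g) ^ p else 0 := by
    have h : (g.expand p hp.out.ne_zero).map (frobenius k p) = g ^ p :=
      MvPowerSeries.map_frobenius_expand (σ := Unit) p hp.out.ne_zero
    rw [← h, PowerSeries.coeff_map, PowerSeries.coeff_expand]
    split_ifs
    · rfl
    · simp
  refine ⟨fun i => PowerSeries.mk fun m =>
    (frobeniusEquiv k p).symm (PowerSeries.coeff (p * m + i) f), ?_⟩
  ext n
  rw [map_sum, Finset.sum_eq_single (n % p)]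
  · rw [PowerSeries.coeff_X_pow_mul', if_pos (Nat.mod_le _ _), hpow,
      if_pos (Nat.dvd_sub_mod n), PowerSeries.coeff_mk, frobeniusEquiv_symm_pow_p,
      Nat.mul_div_cancel' (Nat.dvd_sub_mod n), Nat.sub_add_cancel (Nat.mod_le _ _)]
  · intro i hi hin
    have hi := Finset.mem_range.1 hi
    rw [PowerSeries.coeff_X_pow_mul']
    split_ifs with h
    · rw [hpow, if_neg]
      intro hd
      apply hin
      have := (Nat.modEq_iff_dvd' h).2 hd
      rw [← Nat.mod_eq_of_lt hi]
      exact this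
    · rfl
  · intro h
    exact absurd (Finset.mem_range.2 (Nat.mod_lt _ hp.out.pos)) h

theorem LaurentSeries.spansOverPowers_single {k : Type*} [Field k] [CharP k p] [PerfectField k] :
    SpansOverPowers p (HahnSeries.single (1 : ℤ) (1 : k) : LaurentSeries k) := by
  intro x
  set s : LaurentSeries k := HahnSeries.single 1 1 with hs
  have hs0 : s ≠ 0 := by simp [hs]
  obtain ⟨q, hq⟩ : ∃ q : ℕ, (q : ℤ) = x.order + p * x.order.natAbs := by
    refine ⟨(x.order + p * x.order.natAbs).toNat, Int.toNat_of_nonneg ?_⟩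
    have h1 : (1 : ℤ) ≤ p := by exact_mod_cast hp.out.pos
    have h2 : -x.order ≤ x.order.natAbs := by lia
    nlinarith [Int.natCast_nonneg x.order.natAbs]
  let φ := HahnSeries.ofPowerSeries ℤ k
  have hX : φ PowerSeries.X = s := HahnSeries.ofPowerSeries_X
  obtain ⟨a, ha⟩ := PowerSeries.exists_eq_sum_X_pow_mul_pow (p := p)
    (PowerSeries.X ^ q * LaurentSeries.powerSeriesPart x)
  refine ⟨fun i => s ^ (-(x.order.natAbs : ℤ)) * φ (a i), ?_⟩
  have h1 : x = (s ^ (-(x.order.natAbs : ℤ))) ^ p *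
      φ (PowerSeries.X ^ q * LaurentSeries.powerSeriesPart x) := by
    rw [map_mul, map_pow, hX, ← zpow_natCast, ← zpow_natCast s q, hq, ← zpow_mul, ← mul_assoc,
      ← zpow_add₀ hs0]
    rw [show -(x.order.natAbs : ℤ) * p + (x.order + p * x.order.natAbs) = x.order by ring, hs,
      ← RatFunc.single_zpow, LaurentSeries.single_order_mul_powerSeriesPart]
  refine h1.trans ?_
  rw [ha, map_sum, Finset.mul_sum]
  refine Finset.sum_congr rfl fun i _ => ?_
  rw [map_mul, map_pow, map_pow, hX, mul_pow]
  ring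

end Laurent

theorem SpansOverPowers.intermediateField {p : ℕ} [hp : Fact p.Prime] {K L : Type*} [Field K]
    [Field L] [Algebra K L] [Algebra.IsSeparable K L] [CharP K p] {s : K}
    (hs : SpansOverPowers p s) (F : IntermediateField K L) (z : L) (hz : z ∈ F) :
    ∃ a : ℕ → L, (∀ i, a i ∈ F) ∧
      z = ∑ i ∈ Finset.range p, algebraMap K L s ^ i * a i ^ p := by
  have hL : CharP L p := charP_of_injective_algebraMap (algebraMap K L).injective p
  have : ExpChar K p := ExpChar.prime hp.out
  have : Algebra.IsSeparable K F := inferInstance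
  have h := Field.span_map_pow_expChar_pow_eq_top_of_isSeparable p 1 (F := K) (E := F) (v := id)
    (by rw [Set.range_id, Submodule.span_univ])
  obtain ⟨c, hc⟩ := Finsupp.mem_span_range_iff_exists_finsupp.1
    (h ▸ Submodule.mem_top : (⟨z, hz⟩ : F) ∈ Submodule.span K (Set.range fun x : F => id x ^ p ^ 1))
  have hc' := congrArg (algebraMap F L) hc
  rw [Finsupp.sum, map_sum] at hc'
  change _ = z at hc'
  rw [← hc']
  apply Finset.sum_induction (fun x => algebraMap F L (c x • id x ^ p ^ 1))
    (fun z => ∃ a : ℕ → L, (∀ i, a i ∈ F) ∧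
      z = ∑ i ∈ Finset.range p, algebraMap K L s ^ i * a i ^ p)
  · rintro _ _ ⟨a, ha, rfl⟩ ⟨b, hb, rfl⟩
    refine ⟨a + b, fun i => add_mem (ha i) (hb i), ?_⟩
    rw [← Finset.sum_add_distrib]
    refine Finset.sum_congr rfl fun i _ => ?_
    rw [Pi.add_apply, add_pow_char, mul_add]
  · exact ⟨0, fun _ => zero_mem _, by simp [hp.out.ne_zero]⟩
  · intro x _
    obtain ⟨a, ha⟩ := hs (c x)
    refine ⟨fun i => algebraMap K L (a i) * x, fun i => mul_mem (F.algebraMap_mem _) x.2, ?_⟩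
    rw [Algebra.smul_def, map_mul, ← IsScalarTower.algebraMap_apply, ha, map_sum, Finset.sum_mul]
    refine Finset.sum_congr rfl fun i _ => ?_
    simp only [map_mul, map_pow, id, pow_one, mul_pow, mul_assoc]
    rfl

section Derivation

variable {p : ℕ} [hp : Fact p.Prime] {K L : Type*} [Field K] [Field L] [Algebra K L]
  {v : AddValuation L (WithTop ℤ)}

/-- On a discretely valued field with `p`-basis `s`, the derivations `d / dt` for a uniformizer `t`
and `d / ds` exist, and are proportional. -/
theorem exists_derivation_eq_one [CharP L p] {s t : L} (hs : SpansOverPowers p s) (ht : v t = 1) :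
    ∃ D₁ D : Derivation ℤ L L, D₁ t = 1 ∧ D s = 1 ∧ ∀ x, D₁ x = D₁ s * D x := by
  have hti : IndepOverPowers p t := by
    apply indepOverPowers_of_index (v := v) one_pos ht
    intro x hx
    obtain ⟨k, hk⟩ := exists_eq_coe v hx
    exact ⟨k, by rw [hk, one_mul]⟩
  obtain ⟨D₁, hD₁⟩ := hti.exists_derivation (hti.spansOverPowers hs)
  have h0 : D₁ s ≠ 0 := by
    intro h0
    obtain ⟨a, ha⟩ := hs t
    apply one_ne_zero (α := L)
    rw [← hD₁, ha, map_sum]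
    refine Finset.sum_eq_zero fun i _ => ?_
    rw [derivation_mul_pow_char, D₁.leibniz_pow, h0, smul_zero, smul_zero, zero_mul]
  refine ⟨D₁, (D₁ s)⁻¹ • D₁, hD₁, ?_, fun x => ?_⟩
  · rw [Derivation.smul_apply, smul_eq_mul, inv_mul_cancel₀ h0]
  · rw [Derivation.smul_apply, smul_eq_mul, mul_inv_cancel_left₀ h0]

theorem derivation_mem [CharP L p] {s : L} {E : IntermediateField K L} (hs : s ∈ E)
    (hG : ∀ z ∈ E, ∃ a : ℕ → L, (∀ i, a i ∈ E) ∧ z = ∑ i ∈ Finset.range p, s ^ i * a i ^ p)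
    {D : Derivation ℤ L L} (hD : D s = 1) {z : L} (hz : z ∈ E) : D z ∈ E := by
  obtain ⟨a, ha, rfl⟩ := hG z hz
  rw [map_sum]
  refine sum_mem fun i _ => ?_
  rw [derivation_mul_pow_char, D.leibniz_pow, hD, nsmul_eq_mul, smul_eq_mul, mul_one]
  exact mul_mem (mul_mem (natCast_mem _ _) (pow_mem hs _)) (pow_mem (ha i) _)

end Derivation

section WittTower

variable {p : ℕ} [hp : Fact p.Prime] {K L : Type*} [Field K] [Field L] [Algebra K L]
  {v : AddValuation L (WithTop ℤ)}

theorem coe_le_map_pow_of_artinSchreier {y r : L} (hy : y ^ p - y = r) {B : ℤ} (hB : 0 ≤ B)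
    (hr : ((-B : ℤ) : WithTop ℤ) ≤ v r) : ((-B : ℤ) : WithTop ℤ) ≤ v (y ^ p) := by
  rcases eq_or_ne y 0 with rfl | hy0
  · simp [hp.out.ne_zero]
  have hp1 : (1 : ℤ) < p := by exact_mod_cast hp.out.one_lt
  obtain ⟨a, ha⟩ := exists_eq_coe v hy0
  rcases lt_or_ge a 0 with ha0 | ha0
  · have h1 : v (-y) = a := by rw [v.map_neg, ha]
    have h2 := eq_coe_add_of_lt (eq_coe_pow ha p) h1.ge (by nlinarith)
    rw [← sub_eq_add_neg, hy] at h2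
    rwa [eq_coe_pow ha, ← h2]
  · rw [eq_coe_pow ha]
    have : -B ≤ p * a := by nlinarith
    exact_mod_cast this

/-- The components `wⱼ = yⱼ ^ p - yⱼ` of a solution of the Artin–Schreier–Witt equation with
right-hand side `u`. -/
structure IsWittTower (p : ℕ) [Fact p.Prime] {L : Type*} [Field L] (n : ℕ) (u y w : ℕ → L) :
    Prop where
  coeff_lt : ∀ j ≤ n, ∀ i < j, (WittVector.mk p (fun i => if i < j then y i else 0) +
    WittVector.mk p fun i => if i ≤ j then u i else 0).coeff i = y i ^ p
  coeff_eq : ∀ j ≤ n, (WittVector.mk p (fun i => if i < j then y i else 0) +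
    WittVector.mk p fun i => if i ≤ j then u i else 0).coeff j = w j
  artinSchreier : ∀ j < n, y j ^ p - y j = w j

namespace IsWittTower

variable {n : ℕ} {u y w : ℕ → L}

theorem mem (h : IsWittTower p n u y w) {E : IntermediateField K L} {j : ℕ} (hj : j ≤ n)
    (hu : ∀ i ≤ j, u i ∈ E) (hy : ∀ i < j, y i ∈ E) : w j ∈ E := by
  rw [← h.coeff_eq j hj]
  refine WittVector.coeff_add_mem E.toSubfield.toSubring (fun i => ?_) (fun i => ?_) j
  · rw [WittVector.coeff_mk]
    split_ifs with h
    exacts [hy i h, zero_mem _]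
  · rw [WittVector.coeff_mk]
    split_ifs with h
    exacts [hu i h, zero_mem _]

/-- The form `∑ uᵢ ^ (p ^ (j - i) - 1) duᵢ`. -/
def form (p : ℕ) (D : Derivation ℤ L L) (u : ℕ → L) (j : ℕ) : L :=
  ∑ i ∈ Finset.range (j + 1), u i ^ (p ^ (j - i) - 1) * D (u i)

theorem sum_coeff_mk (D : Derivation ℤ L L) (x : ℕ → L) {P : ℕ → Prop} [DecidablePred P] {l : ℕ}
    (hP : ∀ i ≤ l, P i) :
    ∑ i ∈ Finset.range (l + 1), (WittVector.mk p fun i => if P i then x i else 0).coeff i ^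
      (p ^ (l - i) - 1) • D ((WittVector.mk p fun i => if P i then x i else 0).coeff i) =
      form p D x l := by
  refine Finset.sum_congr rfl fun i hi => ?_
  rw [WittVector.coeff_mk, if_pos (hP i (Finset.mem_range_succ_iff.1 hi)), smul_eq_mul]

theorem form_eq_neg [CharP L p] (h : IsWittTower p n u y w) (D : Derivation ℤ L L) {j : ℕ}
    (hj : j + 1 ≤ n) : form p D y j = - form p D u j := by
  have h1 := WittVector.sum_pow_smul_derivation_add D
    (WittVector.mk p fun i => if i < j + 1 then y i else 0)
    (WittVector.mk p fun i => if i ≤ j + 1 then u i else 0) j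
  rw [sum_coeff_mk D y (fun i hi => by lia), sum_coeff_mk D u (fun i hi => by lia),
    Finset.sum_eq_zero] at h1
  · linear_combination -h1
  · intro i hi
    rw [h.coeff_lt _ hj i (Finset.mem_range.1 hi), derivation_pow_char, smul_zero]

theorem derivation_eq [CharP L p] (h : IsWittTower p n u y w) (D : Derivation ℤ L L) {j : ℕ}
    (hj : j ≤ n) : D (w j) =
      form p D u j + ∑ i ∈ Finset.range j, y i ^ (p ^ (j - i) - 1) * D (y i) := by
  have h1 := WittVector.sum_pow_smul_derivation_add D
    (WittVector.mk p fun i => if i < j then y i else 0)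
    (WittVector.mk p fun i => if i ≤ j then u i else 0) j
  rw [sum_coeff_mk D u (fun i hi => by lia), Finset.sum_range_succ, Finset.sum_range_succ,
    Finset.sum_eq_zero] at h1
  · rw [h.coeff_eq j hj, WittVector.coeff_mk, if_neg (lt_irrefl j), map_zero, smul_zero, add_zero,
      zero_add, Nat.sub_self, pow_zero, Nat.sub_self, pow_zero, one_smul] at h1
    rw [h1, add_comm]
    congr 1
    refine Finset.sum_congr rfl fun i hi => ?_
    rw [if_pos (Finset.mem_range.1 hi), smul_eq_mul]
  · intro i hi
    rw [h.coeff_lt _ hj i (Finset.mem_range.1 hi), derivation_pow_char, smul_zero]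

theorem coe_le_map (h : IsWittTower p n u y w) {t : L} (ht : v t = 1) {j c : ℕ} (hj : j ≤ n)
    (hu : ∀ i ≤ j, ((-(p ^ i * c : ℕ) : ℤ) : WithTop ℤ) ≤ v (u i)) {i : ℕ} (hi : i ≤ j) :
    ((-(p ^ i * c : ℕ) : ℤ) : WithTop ℤ) ≤ v (w i) := by
  induction i using Nat.strong_induction_on with
  | _ i ih =>
    let S : Subring L :=
      { carrier := {x | 0 ≤ v x}
        mul_mem' := fun hx hy => by
          change 0 ≤ v (_ * _)
          rw [v.map_mul]
          exact add_nonneg hx hy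
        one_mem' := v.map_one.ge
        add_mem' := fun hx hy => v.map_le_add hx hy
        zero_mem' := by simp
        neg_mem' := fun hx => by
          change 0 ≤ v (-_)
          rw [v.map_neg]
          exact hx }
    have htc : v (t ^ c) = (c : ℤ) := by
      have := eq_coe_pow (a := 1) ht c
      rwa [mul_one] at this
    have htl (l : ℕ) : v ((t ^ c) ^ p ^ l) = ((p ^ l * c : ℕ) : ℤ) := by
      rw [eq_coe_pow htc]
      push_cast
      rfl
    have hmem {x : L} {l : ℕ} (hx : ((-(p ^ l * c : ℕ) : ℤ) : WithTop ℤ) ≤ v x) :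
        (t ^ c) ^ p ^ l * x ∈ S := by
      have := coe_le_mul (htl l).ge hx
      rwa [add_neg_cancel] at this
    have hy (l : ℕ) (hl : l < i) : ((-(p ^ l * c : ℕ) : ℤ) : WithTop ℤ) ≤ v (y l) := by
      have h1 := coe_le_map_pow_of_artinSchreier (h.artinSchreier l (by lia))
        (Int.natCast_nonneg _) (ih l hl (by lia))
      apply coe_le_of_pow hp.out.pos h1
      have h2 : (1 : ℤ) ≤ p := by exact_mod_cast hp.out.pos
      nlinarith [Int.natCast_nonneg (p ^ l * c)]
    have key := WittVector.coeff_add_mem S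
      (x := WittVector.teichmuller p (t ^ c) *
        WittVector.mk p fun l => if l < i then y l else 0)
      (y := WittVector.teichmuller p (t ^ c) *
        WittVector.mk p fun l => if l ≤ i then u l else 0) (fun l => by
        rw [WittVector.coeff_teichmuller_mul, WittVector.coeff_mk]
        split_ifs with hl
        · exact hmem (hy l hl)
        · rw [mul_zero]
          exact zero_mem _) (fun l => by
        rw [WittVector.coeff_teichmuller_mul, WittVector.coeff_mk]
        split_ifs with hl
        · exact hmem (hu l (by lia))
        · rw [mul_zero]
          exact zero_mem _) i
    rw [← mul_add, WittVector.coeff_teichmuller_mul, h.coeff_eq i (by lia)] at key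
    have h2 := coe_le_div (a := 0) key (htl i)
    rwa [mul_div_cancel_left₀ _ (ne_zero_of_eq_coe (htl i)), zero_sub] at h2

end IsWittTower

end WittTower

section PoleOrder

variable {p : ℕ}

/-- The maximum of `p ^ (j - i) νᵢ` over `i ≤ j`. -/
def maxPoleOrder (p : ℕ) (ν : ℕ → ℕ) (j : ℕ) : ℕ :=
  (Finset.range (j + 1)).sup fun i => p ^ (j - i) * ν i

theorem le_maxPoleOrder (ν : ℕ → ℕ) {i j : ℕ} (hij : i ≤ j) :
    p ^ (j - i) * ν i ≤ maxPoleOrder p ν j :=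
  Finset.le_sup (f := fun i => p ^ (j - i) * ν i) (Finset.mem_range_succ_iff.2 hij)

theorem mul_maxPoleOrder_le (ν : ℕ → ℕ) (j : ℕ) :
    p * maxPoleOrder p ν j ≤ maxPoleOrder p ν (j + 1) := by
  obtain ⟨i, hi, h⟩ := Finset.exists_mem_eq_sup (Finset.range (j + 1)) (by simp)
    fun i => p ^ (j - i) * ν i
  have hi := Finset.mem_range_succ_iff.1 hi
  rw [maxPoleOrder, h]
  refine le_trans (le_of_eq ?_) (le_maxPoleOrder ν (show i ≤ j + 1 by lia))
  rw [Nat.sub_add_comm hi, pow_succ']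
  ring

variable [hp : Fact p.Prime]

theorem pow_mul_ne {i l j a b : ℕ} (hil : i < l) (hl : l ≤ j) (hb : ¬ p ∣ b) :
    p ^ (j - i) * a ≠ p ^ (j - l) * b := by
  intro h
  apply hb
  rw [show j - i = (j - l) + (l - i - 1 + 1) by lia, pow_add, pow_succ, mul_assoc] at h
  rw [← mul_left_cancel₀ (pow_ne_zero _ hp.out.ne_zero) h]
  exact ⟨p ^ (l - i - 1) * a, by ring⟩

end PoleOrder

section Reduction

variable {p : ℕ} [hp : Fact p.Prime] {K L : Type*} [Field K] [Field L] [Algebra K L]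
  {v : AddValuation L (WithTop ℤ)} {D : Derivation ℤ L L} {s : L} {n : ℕ} {u y w : ℕ → L}
  {ν : ℕ → ℕ}

theorem map_form_eq [CharP L p] {e : ℤ} (hbot : IsStage p v (⊥ : IntermediateField K L) e s)
    (hD : D s = 1) {j : ℕ} (hu : ∀ i ≤ j, u i ∈ (⊥ : IntermediateField K L))
    (huv : ∀ i ≤ j, v (u i) = (e * (-ν i) : ℤ)) (hν : ∀ i ≤ j, ¬ p ∣ ν i) :
    v (IsWittTower.form p D u j) = (-(e * (maxPoleOrder p ν j + 1)) : ℤ) := by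
  have hDs : v (D s) = (e - e : ℤ) := by
    rw [hD, sub_self]
    exact v.map_one
  have hterm (i : ℕ) (hi : i ≤ j) : v (u i ^ (p ^ (j - i) - 1) * D (u i)) =
      (-(e * ((p ^ (j - i) * ν i : ℕ) + 1)) : ℤ) := by
    have h1 := hbot.map_derivation_eq hDs (hu i hi) (m := -ν i)
      (by rw [dvd_neg]; exact_mod_cast hν i hi) (huv i hi)
    rw [eq_coe_mul (eq_coe_pow (huv i hi) _) h1]
    congr 1
    rw [Nat.cast_pred (pow_pos hp.out.pos _)]
    push_cast
    ring
  obtain ⟨i, hi, h1, h2⟩ := exists_map_sum_eq (v := v) (s := Finset.range (j + 1)) (by simp)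
    (fun i => u i ^ (p ^ (j - i) - 1) * D (u i)) fun i hi l hl hil _ _ h => by
      have hi := Finset.mem_range_succ_iff.1 hi
      have hl := Finset.mem_range_succ_iff.1 hl
      rw [hterm i hi, hterm l hl] at h
      have h1 : -(e * ((p ^ (j - i) * ν i : ℕ) + 1)) = -(e * ((p ^ (j - l) * ν l : ℕ) + 1)) := by
        exact_mod_cast h
      have h2 := mul_left_cancel₀ hbot.pos.ne' (neg_injective h1)
      have h3 : p ^ (j - i) * ν i = p ^ (j - l) * ν l := by exact_mod_cast add_right_cancel h2
      rcases lt_or_gt_of_ne hil with hlt | hlt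
      · exact pow_mul_ne hlt hl (hν l hl) h3
      · exact pow_mul_ne hlt hi (hν i hi) h3.symm
  have hi := Finset.mem_range_succ_iff.1 hi
  have hmax : maxPoleOrder p ν j = p ^ (j - i) * ν i := by
    refine le_antisymm (Finset.sup_le fun l hl => ?_) (le_maxPoleOrder ν hi)
    have h3 := h2 l hl
    rw [hterm i hi, hterm l (Finset.mem_range_succ_iff.1 hl)] at h3
    have h4 : -(e * ((p ^ (j - i) * ν i : ℕ) + 1)) ≤ -(e * ((p ^ (j - l) * ν l : ℕ) + 1)) := by
      exact_mod_cast h3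
    have h5 := le_of_mul_le_mul_left (neg_le_neg_iff.1 h4) hbot.pos
    have h6 := le_of_add_le_add_right h5
    exact_mod_cast h6
  rw [IsWittTower.form, h1, hterm i hi, hmax]

theorem IsWittTower.coe_le_map_of_maxPoleOrder (h : IsWittTower p n u y w) {t : L} (ht : v t = 1)
    (huv : ∀ i ≤ n, v (u i) = (p ^ n * (-ν i) : ℤ)) {i j : ℕ} (hij : i ≤ j) (hj : j ≤ n) :
    ((-(p ^ i * (p ^ (n - j) * maxPoleOrder p ν j) : ℕ) : ℤ) : WithTop ℤ) ≤ v (w i) := by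
  refine h.coe_le_map ht hj (fun l hl => ?_) hij
  rw [huv l (by lia)]
  have h1 : p ^ n * ν l ≤ p ^ l * (p ^ (n - j) * maxPoleOrder p ν j) := by
    calc p ^ n * ν l = p ^ l * (p ^ (n - j) * (p ^ (j - l) * ν l)) := by
          rw [← mul_assoc, ← mul_assoc, ← pow_add, ← pow_add]
          congr 2
          lia
      _ ≤ _ := by gcongr; exact le_maxPoleOrder ν hl
  have h2 : (p : ℤ) ^ n * ν l ≤ (p ^ l * (p ^ (n - j) * maxPoleOrder p ν j) : ℕ) := by
    exact_mod_cast h1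
  have h3 : -((p ^ l * (p ^ (n - j) * maxPoleOrder p ν j) : ℕ) : ℤ) ≤ p ^ n * (-ν l) := by
    linarith
  exact_mod_cast h3

theorem IsWittTower.coe_le_map_sum [CharP L p] (h : IsWittTower p n u y w) {t : L} (ht : v t = 1)
    (huv : ∀ i ≤ n, v (u i) = (p ^ n * (-ν i) : ℤ)) {j : ℕ} (hj : j < n)
    {E : IntermediateField K L} {e c : ℤ} {τ : L} (hE : IsStage p v E e τ)
    (hD : v (D τ) = (e - c : ℤ)) (hy : ∀ i ≤ j, y i ∈ E) :
    ((-(p ^ n * maxPoleOrder p ν j) - c : ℤ) : WithTop ℤ) ≤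
      v (∑ i ∈ Finset.range (j + 1), y i ^ (p ^ (j + 1 - i) - 1) * D (y i)) := by
  apply v.map_le_sum
  intro i hi
  have hi := Finset.mem_range_succ_iff.1 hi
  rcases eq_or_ne (y i) 0 with h0 | h0
  · simp [h0]
  obtain ⟨a, ha⟩ := exists_eq_coe v h0
  have h1 := coe_le_map_pow_of_artinSchreier (h.artinSchreier i (by lia)) (Int.natCast_nonneg _)
    (h.coe_le_map_of_maxPoleOrder ht huv hi hj.le)
  rw [eq_coe_pow ha] at h1
  have h2 : -((p ^ i * (p ^ (n - j) * maxPoleOrder p ν j) : ℕ) : ℤ) ≤ p * a := by exact_mod_cast h1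
  have h3 : (p : ℤ) ^ (j - i) * -((p ^ i * (p ^ (n - j) * maxPoleOrder p ν j) : ℕ) : ℤ) ≤
      p ^ (j - i) * (p * a) := mul_le_mul_of_nonneg_left h2 (by positivity)
  have h4 : (p : ℤ) ^ (j - i) * -((p ^ i * (p ^ (n - j) * maxPoleOrder p ν j) : ℕ) : ℤ) =
      -(p ^ n * maxPoleOrder p ν j) := by
    rw [show (p : ℤ) ^ n = p ^ (j - i) * p ^ i * p ^ (n - j) by
      rw [← pow_add, ← pow_add]
      congr 1
      lia]
    push_cast
    ring
  have h5 := coe_le_mul (eq_coe_pow ha (p ^ (j + 1 - i) - 1)).ge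
    (hE.le_map_derivation hD (hy i hi) ha.ge)
  refine le_trans ?_ h5
  rw [Nat.cast_pred (pow_pos hp.out.pos _)]
  have h6 : -((p : ℤ) ^ n * maxPoleOrder p ν j) - c ≤
      (((p ^ (j + 1 - i) : ℕ) : ℤ) - 1) * a + (a - c) := by
    rw [Nat.sub_add_comm hi]
    push_cast
    rw [pow_succ]
    linarith
  exact_mod_cast h6

theorem IsWittTower.exists_reduction [CharP L p] (h : IsWittTower p n u y w) {t : L}
    (ht : v t = 1) (huv : ∀ i ≤ n, v (u i) = (p ^ n * (-ν i) : ℤ)) {j : ℕ} (hj : j ≤ n)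
    (hform : ∀ i ≤ n, v (form p D u i) = (-(p ^ n * (maxPoleOrder p ν i + 1)) : ℤ))
    {E : IntermediateField K L} {e c : ℤ} {τ : L} (hE : IsStage p v E e τ)
    (hD : v (D τ) = (e - c : ℤ)) (hDE : ∀ z ∈ E, D z ∈ E) (hu : ∀ i ≤ j, u i ∈ E)
    (hy : ∀ i < j, y i ∈ E) (hc : j ≠ 0 → p ^ n < c)
    (hcM : p ^ n * maxPoleOrder p ν j < p * (p ^ n * (maxPoleOrder p ν j + 1) - c)) :
    ∃ g ∈ E, v (w j - (g ^ p - g)) = (-(p ^ n * (maxPoleOrder p ν j + 1) - c) : ℤ) ∧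
      ∃ m, p ^ n * (maxPoleOrder p ν j + 1) - c = e * m ∧ ¬ (p : ℤ) ∣ m := by
  have hwE : w j ∈ E := h.mem hj hu hy
  have hwB : ((-(p ^ n * maxPoleOrder p ν j) : ℤ) : WithTop ℤ) ≤ v (w j) := by
    have := h.coe_le_map_of_maxPoleOrder ht huv le_rfl hj
    rwa [← mul_assoc, ← pow_add, Nat.add_sub_cancel' hj, Nat.cast_mul, Nat.cast_pow] at this
  have hDw := h.derivation_eq D hj
  have hp1 : (1 : ℤ) < p := by exact_mod_cast hp.out.one_lt
  have hpn : (0 : ℤ) < (p : ℤ) ^ n := by positivity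
  rcases j with _ | j
  · refine hE.exists_reduction hD (b := 0) (f := 0) (B₀ := 0) hwE (zero_mem _) ?_ (hform 0 hj) ?_
      hwB ?_ le_rfl ?_ hcM
    · rw [hDw]
      simp [hp.out.ne_zero]
    · simp [hp.out.ne_zero]
    · simp
    · rw [mul_zero]
      positivity
  set θ := ∑ i ∈ Finset.range (j + 1), y i ^ (p ^ (j + 1 - i) - 1) * D (y i) with hθ
  have hDτ := ne_zero_of_eq_coe hD
  have hyE (i : ℕ) (hi : i ≤ j) : y i ∈ E := hy i (by lia)
  have hζ : form p D u j / D τ ∈ E := div_mem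
    (sum_mem fun i hi => by
      have hi := Finset.mem_range_succ_iff.1 hi
      exact mul_mem (pow_mem (hu i (by lia)) _) (hDE _ (hu i (by lia)))) (hDE _ hE.mem)
  obtain ⟨H, hH, hθH⟩ := hE.exists_sum_cartier hDτ (Finset.range (j + 1)) (y := y)
    (g := fun i => y i ^ (p ^ (j - i) - 1)) (fun i hi => hyE i (Finset.mem_range_succ_iff.1 hi))
    fun i hi => pow_mem (hyE i (Finset.mem_range_succ_iff.1 hi)) _
  have hsum : ∑ i ∈ Finset.range (j + 1), (y i ^ (p ^ (j - i) - 1)) ^ p * y i ^ (p - 1) * D (y i) =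
      θ := by
    refine Finset.sum_congr rfl fun i hi => ?_
    have hi := Finset.mem_range_succ_iff.1 hi
    rw [← pow_mul, ← pow_add]
    congr 2
    rw [Nat.sub_add_comm hi, pow_succ, Nat.sub_mul, one_mul]
    have h1 := hp.out.pos
    have h2 : 1 * p ≤ p ^ (j - i) * p := Nat.mul_le_mul_right _ (Nat.pow_pos h1)
    lia
  have hform' : ∑ i ∈ Finset.range (j + 1), y i ^ (p ^ (j - i) - 1) * D (y i) =
      - form p D u j := h.form_eq_neg D hj
  rw [hsum, hform'] at hθH
  have hθE : θ ∈ E := sum_mem fun i hi => by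
    have hi := Finset.mem_range_succ_iff.1 hi
    exact mul_mem (pow_mem (hyE i hi) _) (hDE _ (hyE i hi))
  obtain ⟨b, hb, f, hf, hbf, hfv⟩ := hE.exists_add_derivation (D := D)
    (div_mem hθE (hDE _ hE.mem))
    (coe_le_div (h.coe_le_map_sum ht huv (by lia) hE hD hyE) hD)
  rw [div_mul_cancel₀ _ hDτ] at hbf
  have hb0 : b - -form p D u j / D τ = 0 := by
    refine hE.eq_zero_of_eq_derivation hDτ (sub_mem hb ?_) (sub_mem hH hf) ?_
    · rw [neg_div]
      exact neg_mem hζ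
    · rw [sub_pow_char, map_sub]
      linear_combination hθH - hbf
  have hbv : v b = (-(p ^ n * (maxPoleOrder p ν j + 1)) - (e - c) : ℤ) := by
    rw [sub_eq_zero.1 hb0, neg_div, v.map_neg]
    exact eq_coe_div (hform j (by lia)) hD
  have hM : (p : ℤ) * maxPoleOrder p ν j ≤ maxPoleOrder p ν (j + 1) := by
    exact_mod_cast mul_maxPoleOrder_le ν j
  have hpM : (p : ℤ) ^ n * (p * maxPoleOrder p ν j) ≤ p ^ n * maxPoleOrder p ν (j + 1) :=
    mul_le_mul_of_nonneg_left hM hpn.le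
  refine hE.exists_reduction hD hwE hf (by rw [hDw, hbf]) (hform (j + 1) hj) ?_ hwB
    (B₀ := p ^ n * maxPoleOrder p ν j) ?_ (by positivity) (by linarith) hcM
  · rw [eq_coe_mul (eq_coe_mul (eq_coe_pow hE.val _) (eq_coe_pow hbv _)) hD,
      Nat.cast_pred hp.out.pos]
    have hcn : (p : ℤ) ^ n + 1 ≤ c := hc (by lia)
    have h1 : ((p : ℤ) - 1) * (p ^ n + 1) ≤ (p - 1) * c :=
      mul_le_mul_of_nonneg_left hcn (by linarith)
    have h2 : -((p : ℤ) ^ n * (maxPoleOrder p ν (j + 1) + 1)) + 1 ≤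
        (p - 1) * e + p * (-(p ^ n * (maxPoleOrder p ν j + 1)) - (e - c)) + (e - c) := by
      nlinarith
    exact_mod_cast h2
  · convert hfv using 2
    ring

end Reduction

section Tower

variable {p : ℕ} [hp : Fact p.Prime] {K L : Type*} [Field K] [Field L] [Algebra K L]
  {v : AddValuation L (WithTop ℤ)} {D : Derivation ℤ L L} {s : L} {n : ℕ} {u y w : ℕ → L}
  {ν : ℕ → ℕ}

theorem IsWittTower.exists_isStage [CharP L p] (h : IsWittTower p n u y w)
    (hbot : IsStage p v (⊥ : IntermediateField K L) (p ^ n : ℤ) s)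
    (hG : ∀ F : IntermediateField K L, ∀ z ∈ F, ∃ a : ℕ → L, (∀ i, a i ∈ F) ∧
      z = ∑ i ∈ Finset.range p, s ^ i * a i ^ p)
    (hD : D s = 1) {t : L} (ht : v t = 1)
    (hu : ∀ i ≤ n, u i ∈ (⊥ : IntermediateField K L))
    (huv : ∀ i ≤ n, v (u i) = (p ^ n * (-ν i) : ℤ)) (hν : ∀ i ≤ n, 0 < ν i ∧ ¬ p ∣ ν i)
    {j : ℕ} (hj : j ≤ n) :
    ∃ E : IntermediateField K L, (∀ i < j, y i ∈ E) ∧ ∃ (τ : L) (c : ℤ),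
      IsStage p v E (p ^ (n - j) : ℤ) τ ∧ v (D τ) = (p ^ (n - j) - c : ℤ) ∧ p ^ n ≤ c ∧
      (j ≠ 0 → p ^ n < c) ∧
      p ^ n * maxPoleOrder p ν j < p * (p ^ n * (maxPoleOrder p ν j + 1) - c) := by
  have hform (i : ℕ) (hi : i ≤ n) :
      v (form p D u i) = (-(p ^ n * (maxPoleOrder p ν i + 1)) : ℤ) :=
    map_form_eq hbot hD (fun l hl => hu l (by lia)) (fun l hl => huv l (by lia))
      fun l hl => (hν l (by lia)).2
  have hp2 : (2 : ℤ) ≤ p := by exact_mod_cast hp.out.two_le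
  have hpn : (0 : ℤ) < (p : ℤ) ^ n := by positivity
  have hM (i : ℕ) (hi : i ≤ n) : (1 : ℤ) ≤ maxPoleOrder p ν i := by
    have h1 := le_maxPoleOrder (p := p) ν (le_refl i)
    rw [Nat.sub_self, pow_zero, one_mul] at h1
    have h2 := (hν i hi).1
    exact_mod_cast h2.trans_le h1
  induction j with
  | zero =>
    refine ⟨⊥, fun i hi => absurd hi (Nat.not_lt_zero i), s, p ^ n, hbot, ?_, le_rfl,
      fun h => absurd rfl h, ?_⟩
    · rw [hD, Nat.sub_zero, sub_self]
      exact v.map_one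
    · have h1 := mul_pos hpn (zero_lt_one.trans_le (hM 0 hj))
      nlinarith
  | succ j ih =>
    obtain ⟨E, hyE, τ, c, hE, hDτ, hc, hc', hcM⟩ := ih (by lia)
    have hDE (z : L) (hz : z ∈ E) : D z ∈ E := by
      have hsE : s ∈ E := (bot_le : ⊥ ≤ E) hbot.mem
      exact derivation_mem hsE (hG E) hD hz
    have huE (i : ℕ) (hi : i ≤ j) : u i ∈ E := (bot_le : ⊥ ≤ E) (hu i (by lia))
    obtain ⟨g, hg, hgv, m, hm, hpm⟩ := h.exists_reduction ht huv (by lia) hform hE hDτ hDE huE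
      hyE hc' hcM
    have hr : w j - (g ^ p - g) ∈ E :=
      sub_mem (h.mem (by lia) huE hyE) (sub_mem (pow_mem hg _) hg)
    have hM0 : (0 : ℤ) < p ^ n * maxPoleOrder p ν j :=
      mul_pos hpn (zero_lt_one.trans_le (hM j (by lia)))
    have hpos : (0 : ℤ) < p ^ n * (maxPoleOrder p ν j + 1) - c := by
      by_contra! h0
      nlinarith
    rw [hm] at hgv hpos
    have hDr : v (D (w j - (g ^ p - g))) = (-(p ^ n * (maxPoleOrder p ν j + 1)) : ℤ) := by
      rw [hE.map_derivation_eq hDτ hr (m := -m) (by rwa [dvd_neg]) (by rw [hgv, mul_neg]),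
        mul_neg, ← hm]
      congr 1
      ring
    have he : (p : ℤ) ^ (n - j) = p * p ^ (n - (j + 1)) := by
      rw [← pow_succ']
      congr 1
      lia
    obtain ⟨F, hEF, hyF, τ', hF, hDτ'⟩ := hE.exists_step ((bot_le : ⊥ ≤ E) hbot.mem) hG hr
      (y := y j - g)
      (by rw [sub_pow_char, ← h.artinSchreier j (by lia)]; ring) he hpm hpos hgv hDr
    have hyjF : y j ∈ F := by
      have := add_mem hyF (hEF hg)
      rwa [sub_add_cancel] at this
    have hpc : (p : ℤ) * (p ^ n * (maxPoleOrder p ν j + 1) - p ^ (n - (j + 1)) * m) =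
        p * (p ^ n * (maxPoleOrder p ν j + 1)) - (p ^ n * (maxPoleOrder p ν j + 1) - c) := by
      rw [hm, he]
      ring
    have hcn : (p : ℤ) ^ n <
        p ^ n * (maxPoleOrder p ν j + 1) - p ^ (n - (j + 1)) * m := by
      apply lt_of_mul_lt_mul_left (a := (p : ℤ)) _ (by lia)
      rw [hpc]
      nlinarith
    refine ⟨F, fun i hi => ?_, τ', _, hF, hDτ', hcn.le, fun _ => hcn, ?_⟩
    · rcases Nat.lt_succ_iff_lt_or_eq.1 hi with hi | rfl
      exacts [hEF (hyE i hi), hyjF]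
    · rw [mul_sub (p : ℤ), hpc]
      have h1 : (p : ℤ) * maxPoleOrder p ν j ≤ maxPoleOrder p ν (j + 1) := by
        exact_mod_cast mul_maxPoleOrder_le ν j
      have h2 := mul_le_mul_of_nonneg_left h1 hpn.le
      rw [← hm] at hpos
      have h3 : (0 : ℤ) ≤ (p - 1) * (p ^ n * maxPoleOrder p ν (j + 1) -
          p ^ n * (p * maxPoleOrder p ν j)) := mul_nonneg (by linarith) (by linarith)
      have h4 : (0 : ℤ) ≤ (p - 2) * (p * (p ^ n * maxPoleOrder p ν j)) :=
        mul_nonneg (by linarith) (by positivity)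
      linarith

/-- If `y₀, …, yₙ₋₁` generate `L`, then `wₙ` can be changed by some `h ^ p - h` to have valuation
`-(p ^ n M - v (D₁ s) + p ^ n - 1)`, where `D₁` is the derivation with `D₁ t = 1` at a
uniformizer `t`. -/
theorem IsWittTower.exists_map_sub_eq [CharP L p] (h : IsWittTower p n u y w)
    (hbot : IsStage p v (⊥ : IntermediateField K L) (p ^ n : ℤ) s)
    (hG : ∀ F : IntermediateField K L, ∀ z ∈ F, ∃ a : ℕ → L, (∀ i, a i ∈ F) ∧
      z = ∑ i ∈ Finset.range p, s ^ i * a i ^ p)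
    (hD : D s = 1) {t : L} (ht : v t = 1) {D₁ : Derivation ℤ L L} (hD₁ : D₁ t = 1)
    (hDD : ∀ x, D₁ x = D₁ s * D x)
    (hu : ∀ i ≤ n, u i ∈ (⊥ : IntermediateField K L))
    (huv : ∀ i ≤ n, v (u i) = (p ^ n * (-ν i) : ℤ)) (hν : ∀ i ≤ n, 0 < ν i ∧ ¬ p ∣ ν i)
    (htop : ∀ E : IntermediateField K L, (∀ i < n, y i ∈ E) → E = ⊤) {d : ℤ}
    (hd : v (D₁ s) = d) :
    ∃ g : L, v (w n - (g ^ p - g)) = (-(p ^ n * maxPoleOrder p ν n - (d - p ^ n + 1)) : ℤ) := by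
  obtain ⟨E, hyE, τ, c, hE, hDτ, hc, hc', hcM⟩ :=
    h.exists_isStage hbot hG hD ht hu huv hν le_rfl
  obtain rfl := htop E hyE
  rw [Nat.sub_self, pow_zero] at hE hDτ
  have hform (i : ℕ) (hi : i ≤ n) :
      v (form p D u i) = (-(p ^ n * (maxPoleOrder p ν i + 1)) : ℤ) :=
    map_form_eq hbot hD (fun l hl => hu l (by lia)) (fun l hl => huv l (by lia))
      fun l hl => (hν l (by lia)).2
  obtain ⟨g, _, hgv, _⟩ := h.exists_reduction ht huv le_rfl hform hE hDτ
    (fun _ _ => IntermediateField.mem_top) (fun _ _ => IntermediateField.mem_top)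
    (fun _ _ => IntermediateField.mem_top) hc' hcM
  refine ⟨g, ?_⟩
  have h1 := hE.map_derivation_eq hDτ (x := t) IntermediateField.mem_top (m := 1)
    IsStage.not_dvd_one (by rw [ht]; rfl)
  have h2 := eq_coe_mul hd h1
  rw [← hDD, hD₁, v.map_one] at h2
  have h3 : (0 : ℤ) = d + (1 * 1 - c) := by exact_mod_cast h2
  rw [hgv]
  congr 1
  linarith

end Tower

section Module

variable {A M : Type*} [CommRing A] [AddCommGroup M] [Module A M] {g : A}

theorem smul_smul_eq_zero (r : A) {m : M} (h : g • m = 0) : g • r • m = 0 := by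
  rw [smul_comm, h, smul_zero]

theorem smul_eq_zero_of_span_eq_top {S : Set M} (hS : Submodule.span A S = ⊤)
    (hg : ∀ m ∈ S, g • m = 0) (m : M) : g • m = 0 := by
  have hm : m ∈ Submodule.span A S := hS ▸ Submodule.mem_top
  induction hm using Submodule.span_induction with
  | mem m hm => exact hg m hm
  | zero => rw [smul_zero]
  | add x y _ _ hx hy => rw [smul_add, hx, hy, add_zero]
  | smul a x _ hx => exact smul_smul_eq_zero a hx

end Module

section Different

variable {p : ℕ} [hp : Fact p.Prime] {K L : Type*} [Field K] [Field L] [Algebra K L]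
  {v : AddValuation L (WithTop ℤ)}

/-- If `D₁` is the derivation of `L` with `D₁ t = 1` at a uniformizer `t`, and `s` is a uniformizer
and `p`-basis of `K`, then `v (D₁ s)` is the exponent of the different of `L / K`. -/
theorem map_derivation_eq_of_annihilator [CharP L p] {D₁ D : Derivation ℤ L L} {s : L} {e : ℤ}
    (hbot : IsStage p v (⊥ : IntermediateField K L) e s) (hD : D s = 1)
    {OL OK : Subring L} (hOL : ∀ z, z ∈ OL ↔ 0 ≤ v z)
    (hOK : ∀ z, z ∈ OK ↔ z ∈ (⊥ : IntermediateField K L) ∧ 0 ≤ v z) (hle : OK ≤ OL) {t : OL}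
    (htop : IsStage p v (⊤ : IntermediateField K L) 1 (t : L)) (hD₁ : D₁ (t : L) = 1)
    (hDD : ∀ x, D₁ x = D₁ s * D x) {d : ℕ}
    (hd : letI := (Subring.inclusion hle).toAlgebra;
      Module.annihilator ↥OL (KaehlerDifferential ↥OK ↥OL) = Ideal.span {t} ^ d) :
    v (D₁ s) = (d : ℤ) := by
  let := (Subring.inclusion hle).toAlgebra
  have hsv : 0 ≤ v s := by
    rw [hbot.val]
    exact_mod_cast hbot.pos.le
  have hsK : s ∈ OK := (hOK s).2 ⟨hbot.mem, hsv⟩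
  have hmem (x : OL) : D₁ (x : L) ∈ OL := by
    obtain ⟨q, hq, hx⟩ := htop.exists_derivation_eq_mul (D := D₁) (x := (x : L))
      IntermediateField.mem_top ((hOL x).1 x.2)
    rw [hx, hD₁, mul_one]
    exact (hOL q).2 hq
  let g : OL := ⟨D₁ s, hmem ⟨s, hle hsK⟩⟩
  have hOKg (x : OK) : (⟨D₁ x, hmem ⟨x, hle x.2⟩⟩ : OL) ∈ Ideal.span {g} := by
    obtain ⟨hx1, hx2⟩ := (hOK x).1 x.2
    obtain ⟨q, hq, hx⟩ := hbot.exists_derivation_eq_mul (D := D) hx1 hx2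
    rw [hD, mul_one] at hx
    refine Ideal.mem_span_singleton.2 ⟨⟨q, (hOL q).2 hq⟩, Subtype.ext ?_⟩
    change D₁ x = D₁ s * q
    rw [hDD, hx]
  let Δ : Derivation OK OL (OL ⧸ Ideal.span {g}) := Derivation.mk'
    { toFun := fun x => Ideal.Quotient.mk _ (⟨D₁ x, hmem x⟩ : OL)
      map_add' := fun x y => by
        rw [← map_add]
        congr 1
        exact Subtype.ext (D₁.map_add _ _)
      map_smul' := fun r x => by
        rw [RingHom.id_apply, Algebra.smul_def, Algebra.smul_def,
          IsScalarTower.algebraMap_apply OK OL (OL ⧸ Ideal.span {g})]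
        change _ = Ideal.Quotient.mk _ _ * _
        rw [← map_mul, Ideal.Quotient.eq]
        convert Ideal.mul_mem_left _ x (hOKg r) using 1
        apply Subtype.ext
        change D₁ ((r : L) * x) - r * D₁ x = x * D₁ r
        rw [D₁.leibniz, smul_eq_mul, smul_eq_mul]
        ring }
    fun a b => by
      change Ideal.Quotient.mk _ _ = a • Ideal.Quotient.mk _ _ + b • Ideal.Quotient.mk _ _
      rw [Algebra.smul_def, Algebra.smul_def]
      change _ = Ideal.Quotient.mk _ _ * _ + Ideal.Quotient.mk _ _ * _
      rw [← map_mul, ← map_mul, ← map_add]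
      congr 1
      exact Subtype.ext (D₁.leibniz _ _)
  let δ := KaehlerDifferential.D OK OL
  have hp0 : (p : OL) = 0 := Subtype.ext (CharP.cast_eq_zero L p)
  have hδp (a b : OL) : δ (a * b ^ p) = b ^ p • δ a := by
    rw [δ.leibniz, δ.leibniz_pow, ← Nat.cast_smul_eq_nsmul OL, hp0, zero_smul, smul_zero, zero_add]
  have hδ (x : OL) : δ x = (⟨D₁ x, hmem x⟩ : OL) • δ t := by
    obtain ⟨a, -, hx, hxa⟩ := htop.exists_digits (x := (x : L)) IntermediateField.mem_top
    have ha (i : ℕ) (hi : i < p) : a i ∈ OL := (hOL _).2 <|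
      htop.map_digit_nonneg IntermediateField.mem_top hi
        (le_trans ((hOL x).1 x.2) (hxa i hi))
    let b : ℕ → OL := fun i => if hi : i < p then ⟨a i, ha i hi⟩ else 0
    have hb (i : ℕ) (hi : i ∈ Finset.range p) : (b i : L) = a i := by
      simp only [b, dif_pos (Finset.mem_range.1 hi)]
    have hxb : x = ∑ i ∈ Finset.range p, t ^ i * b i ^ p := by
      apply Subtype.ext
      rw [hx]
      push_cast
      exact Finset.sum_congr rfl fun i hi => by rw [hb i hi]
    have hDx : (⟨D₁ x, hmem x⟩ : OL) = ∑ i ∈ Finset.range p, b i ^ p * (i * t ^ (i - 1)) := by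
      apply Subtype.ext
      change D₁ x = _
      rw [hx, map_sum]
      push_cast
      refine Finset.sum_congr rfl fun i hi => ?_
      rw [derivation_mul_pow_char, D₁.leibniz_pow, hD₁, nsmul_eq_mul, smul_eq_mul, hb i hi]
      ring
    rw [hDx, Finset.sum_smul]
    conv_lhs => rw [hxb]
    rw [map_sum]
    refine Finset.sum_congr rfl fun i _ => ?_
    rw [hδp, δ.leibniz_pow, ← Nat.cast_smul_eq_nsmul OL, smul_smul, smul_smul, mul_assoc]
  have hann : Module.annihilator OL (KaehlerDifferential OK OL) = Ideal.span {g} := by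
    apply le_antisymm
    · intro r hr
      have h1 := congrArg Δ.liftKaehlerDifferential (Module.mem_annihilator.1 hr (δ t))
      rw [map_smul, Derivation.liftKaehlerDifferential_comp_D, map_zero] at h1
      rw [← Ideal.Quotient.eq_zero_iff_mem, ← h1, Algebra.smul_def]
      change _ = Ideal.Quotient.mk _ _ * Ideal.Quotient.mk _ _
      rw [← map_mul]
      congr 1
      apply Subtype.ext
      change _ = _ * D₁ t
      rw [hD₁, mul_one]
    · rw [Ideal.span_singleton_le_iff_mem, Module.mem_annihilator]
      have hg : g • δ t = 0 := by
        have h1 : δ (⟨s, hle hsK⟩ : OL) = 0 := δ.map_algebraMap (⟨s, hsK⟩ : OK)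
        rw [← h1]
        exact (hδ ⟨s, hle hsK⟩).symm
      refine smul_eq_zero_of_span_eq_top (KaehlerDifferential.span_range_derivation OK OL) ?_
      rintro _ ⟨x, rfl⟩
      change g • δ x = 0
      rw [hδ]
      exact smul_smul_eq_zero _ hg
  have hspan : Ideal.span {g} = Ideal.span {t ^ d} := by
    rw [← hann, ← Ideal.span_singleton_pow]
    exact hd
  obtain ⟨a, ha⟩ := Ideal.span_singleton_le_span_singleton.1 hspan.le
  obtain ⟨b, hb⟩ := Ideal.span_singleton_le_span_singleton.1 hspan.ge
  have htd : v ((t : L) ^ d) = ((d * 1 : ℤ) : WithTop ℤ) := eq_coe_pow htop.val d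
  have ha' : D₁ s = (t : L) ^ d * a := congrArg Subtype.val ha
  have hb' : (t : L) ^ d = D₁ s * b := congrArg Subtype.val hb
  rw [mul_one] at htd
  apply le_antisymm
  · rw [← htd, hb', v.map_mul]
    exact le_add_of_nonneg_right ((hOL b).1 b.2)
  · rw [← htd, ha', v.map_mul]
    exact le_add_of_nonneg_right ((hOL a).1 a.2)

end Different

section Descent

variable {p : ℕ} [hp : Fact p.Prime]

theorem WittVector.coeff_mk_add_mk {R : Type*} [CommRing R] (x z : WittVector p R) (j : ℕ) :
    (∀ i < j, (mk p (fun i => if i < j then x.coeff i else 0) +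
      mk p fun i => if i ≤ j then z.coeff i else 0).coeff i = (x + z).coeff i) ∧
    (mk p (fun i => if i < j then x.coeff i else 0) +
      mk p fun i => if i ≤ j then z.coeff i else 0).coeff j = (x + z).coeff j - x.coeff j := by
  have hx : mk p (fun i => if i < j then x.coeff i else 0) = init j x := by
    ext i
    rw [coeff_init, coeff_mk]
  have hz : mk p (fun i => if i ≤ j then z.coeff i else 0) = init (j + 1) z := by
    ext i
    rw [coeff_init, coeff_mk]
    simp only [Nat.lt_succ_iff]
  have hxz : x + z = init j x + init (j + 1) z + tail j x + tail (j + 1) z := by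
    conv_lhs => rw [← init_add_tail x j, ← init_add_tail z (j + 1)]
    ring
  obtain ⟨h1, h2⟩ := coeff_add_of_forall_lt_eq_zero (init j x + init (j + 1) z) (tail j x) j
    fun i hi => by rw [coeff_tail, if_neg hi.not_ge]
  obtain ⟨h3, -⟩ := coeff_add_of_forall_lt_eq_zero (init j x + init (j + 1) z + tail j x)
    (tail (j + 1) z) (j + 1) fun i hi => by rw [coeff_tail, if_neg hi.not_ge]
  rw [hx, hz, hxz]
  refine ⟨fun i hi => ?_, ?_⟩
  · rw [h3 i (by lia), h1 i hi]
  · rw [h3 j (by lia), h2, coeff_tail, if_pos le_rfl, add_sub_cancel_right]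

theorem IsWittTower.of_map {L Ω : Type*} [Field L] [Field Ω] (f : L →+* Ω) {n : ℕ}
    {x z : WittVector p Ω} (hxz : ∀ i ≤ n, (x + z).coeff i = x.coeff i ^ p) {u y w : ℕ → L}
    (hu : ∀ i ≤ n, f (u i) = z.coeff i) (hy : ∀ i < n, f (y i) = x.coeff i)
    (hw : ∀ i ≤ n, f (w i) = x.coeff i ^ p - x.coeff i) : IsWittTower p n u y w := by
  have hmap {j : ℕ} (hj : j ≤ n) (i : ℕ) :
      f ((WittVector.mk p (fun i => if i < j then y i else 0) +
        WittVector.mk p fun i => if i ≤ j then u i else 0).coeff i) =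
      (WittVector.mk p (fun i => if i < j then x.coeff i else 0) +
        WittVector.mk p fun i => if i ≤ j then z.coeff i else 0).coeff i := by
    rw [← WittVector.map_coeff, map_add]
    congr 2
    · ext i
      rw [WittVector.map_coeff, WittVector.coeff_mk, WittVector.coeff_mk]
      split_ifs with hi
      exacts [hy i (by lia), map_zero f]
    · ext i
      rw [WittVector.map_coeff, WittVector.coeff_mk, WittVector.coeff_mk]
      split_ifs with hi
      exacts [hu i (by lia), map_zero f]
  refine ⟨fun j hj i hi => f.injective ?_, fun j hj => f.injective ?_,
    fun j hj => f.injective ?_⟩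
  · rw [hmap hj, (WittVector.coeff_mk_add_mk x z j).1 i hi, hxz i (by lia), map_pow,
      hy i (by lia)]
  · rw [hmap hj, (WittVector.coeff_mk_add_mk x z j).2, hxz j hj, hw j hj]
  · rw [map_sub, map_pow, hy j hj, hw j hj.le]

theorem coeff_out_add_out {R : Type*} [CommRing R] {m : ℕ} {y z : TruncatedWittVector p m R}
    (h : twFrobenius p m y - y = z) (i : Fin m) :
    (y.out + z.out).coeff i = y.coeff i ^ p := by
  rw [← WittVector.coeff_truncateFun, WittVector.truncateFun_add,
    TruncatedWittVector.truncateFun_out, TruncatedWittVector.truncateFun_out, ← h,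
    add_sub_cancel, twFrobenius, TruncatedWittVector.coeff_mk]

end Descent

/-- In the Artin–Schreier–Witt tower setting of length `n+1` (with `n ≥ 1`),
let `w = y_n^p − y_n ∈ L_n`, let `M = max_{0≤i≤n} p^{n−i} ν_i` and let
`μ_n = deg𝔇_{L_n/K} − p^n + 1`. Then there is `h ∈ L_n` with
`v_{L_n}(w − (h^p − h)) = −(p^n·M − μ_n)`. -/
theorem asw_main_adjusted_valuation (p : ℕ) [Fact p.Prime] (k : Type*) [Field k] [CharP k p]
    [PerfectField k] (n : ℕ) (hn : 1 ≤ n)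
    -- `K` is the field `k((s))` of Laurent series over `k`, with valuation `v_K = order ∘ ι`
    (K : Type*) [Field K] (ι : K ≃+* LaurentSeries k)
    -- the Witt vector `u` of length `n+1` over `K`, with pole orders `ν_i` prime to `p`
    (u : TruncatedWittVector p (n + 1) K)
    (ν : ℕ → ℕ) (hν : ∀ i ≤ n, 0 < ν i ∧ ¬ p ∣ ν i)
    (hu : ∀ i : Fin (n + 1), u.coeff i ≠ 0)
    (hord : ∀ i : Fin (n + 1), (ι (u.coeff i)).order = -(ν i.val : ℤ))
    -- a separable closure `Ω` of `K` and a solution `y` of `F(y) − y = u` with entries in `Ω`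
    (Ω : Type*) [Field Ω] [Algebra K Ω] [IsSepClosed Ω] [Algebra.IsSeparable K Ω]
    (y : TruncatedWittVector p (n + 1) Ω)
    (hy : twFrobenius p (n + 1) y - y = twMap p (n + 1) (algebraMap K Ω) u)
    -- `L_n = K(y_0, …, y_{n−1})`, cyclic totally ramified of degree `p^n` over `K`
    (Ln : IntermediateField K Ω)
    (hLn : Ln = IntermediateField.adjoin K {x | ∃ i : Fin (n + 1), i.val < n ∧ y.coeff i = x})
    [IsGalois K ↥Ln] [FiniteDimensional K ↥Ln] [IsCyclic (↥Ln ≃ₐ[K] ↥Ln)]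
    (hdeg : Module.finrank K ↥Ln = p ^ n)
    -- the normalized valuation `v_{L_n}` of `L_n`
    (v : ↥Ln → WithTop ℤ) (hv : IsAddValuation v)
    (hvK : ∀ x : K, x ≠ 0 →
      v (algebraMap K ↥Ln x) = ((p ^ n * (ι x).order : ℤ) : WithTop ℤ))
    -- the valuation rings `O_{L_n}` and `O_K` (inside `L_n`), and a uniformizer of `O_{L_n}`
    (OL OK : Subring ↥Ln)
    (hOL : ∀ z, z ∈ OL ↔ 0 ≤ v z)
    (hOK : ∀ z, z ∈ OK ↔ ∃ x : K, 0 ≤ (ι x).order ∧ algebraMap K ↥Ln x = z)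
    (hle : OK ≤ OL)
    (t : ↥OL) (ht : v (t : ↥Ln) = 1)
    -- `d = deg𝔇_{L_n/K}`: the different `Ann(Ω¹_{O_{L_n}/O_K})` is the `d`-th power of the
    -- maximal ideal of `O_{L_n}`, and `μ_n = d − p^n + 1`
    (d : ℕ)
    (hd : letI := (Subring.inclusion hle).toAlgebra;
      Module.annihilator ↥OL (KaehlerDifferential ↥OK ↥OL) = Ideal.span {t} ^ d)
    (μ : ℤ) (hμ : μ = (d : ℤ) - p ^ n + 1)
    -- the element `w = y_n^p − y_n` lies in `L_n`
    (hw : y.coeff (Fin.last n) ^ p - y.coeff (Fin.last n) ∈ Ln) :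
    ∃ h : ↥Ln,
      v ((⟨y.coeff (Fin.last n) ^ p - y.coeff (Fin.last n), hw⟩ : ↥Ln) - (h ^ p - h)) =
        ((-((p : ℤ) ^ n *
            (((Finset.range (n + 1)).sup fun i => p ^ (n - i) * ν i : ℕ) : ℤ) - μ) : ℤ) :
          WithTop ℤ) := by
  have hp : Fact p.Prime := inferInstance
  have hck : CharP (LaurentSeries k) p :=
    charP_of_injective_algebraMap (algebraMap k (LaurentSeries k)).injective p
  have hcK : CharP K p :=
    charP_of_injective_ringHom (f := (ι.symm : LaurentSeries k →+* K)) ι.symm.injective p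
  have hcL : CharP Ln p := charP_of_injective_algebraMap (algebraMap K Ln).injective p
  have hsep : Algebra.IsSeparable K Ln := inferInstance
  obtain ⟨hv0, hvm, hva⟩ := hv
  have hv1 : v 1 = 0 := by
    have h1 := hvm 1 1
    rw [mul_one] at h1
    obtain ⟨m, hm⟩ := WithTop.ne_top_iff_exists.1 (fun h => one_ne_zero ((hv0 1).1 h))
    rw [← hm] at h1 ⊢
    have h2 : m = m + m := by exact_mod_cast h1
    have h3 : m = 0 := by lia
    rw [h3]
    rfl
  let V : AddValuation Ln (WithTop ℤ) := AddValuation.of v ((hv0 0).2 rfl) hv1 hva hvm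
  have hVv (x : Ln) : V x = v x := rfl
  let s : K := ι.symm (HahnSeries.single 1 1)
  have hιs : ι s = HahnSeries.single 1 1 := ι.apply_symm_apply _
  have hs : SpansOverPowers p s := by
    intro x
    obtain ⟨a, ha⟩ := LaurentSeries.spansOverPowers_single (p := p) (ι x)
    refine ⟨fun i => ι.symm (a i), ?_⟩
    apply ι.injective
    rw [ha, map_sum]
    refine Finset.sum_congr rfl fun i _ => ?_
    rw [map_mul, map_pow, map_pow, hιs, ι.apply_symm_apply]
  have hs0 : s ≠ 0 := by
    intro h0
    rw [h0, map_zero] at hιs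
    exact HahnSeries.single_ne_zero one_ne_zero hιs.symm
  have hpn : (0 : ℤ) < (p : ℤ) ^ n := pow_pos (by exact_mod_cast hp.out.pos) n
  have hsv : V (algebraMap K Ln s) = ((p ^ n : ℤ) : WithTop ℤ) := by
    rw [hVv, hvK s hs0, hιs, HahnSeries.order_single one_ne_zero, mul_one]
  have hG := fun F : IntermediateField K Ln => hs.intermediateField F
  have hbot : IsStage p V (⊥ : IntermediateField K Ln) (p ^ n : ℤ) (algebraMap K Ln s) := by
    refine isStage_of_index (hG ⊥) (IntermediateField.algebraMap_mem _ s) hpn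
      (IntermediateField.algebraMap_mem _ s) hsv fun x hx hx0 => ?_
    obtain ⟨x, rfl⟩ := IntermediateField.mem_bot.1 hx
    exact ⟨_, hvK x fun h => hx0 (by rw [h, map_zero])⟩
  have hVt : V (t : Ln) = 1 := ht
  have htop : IsStage p V (⊤ : IntermediateField K Ln) 1 (t : Ln) := by
    refine isStage_of_index (hG ⊤) (s := algebraMap K Ln s) IntermediateField.mem_top one_pos
      IntermediateField.mem_top hVt fun x _ hx0 => ?_
    obtain ⟨m, hm⟩ := exists_eq_coe V hx0
    exact ⟨m, by rw [hm, one_mul]⟩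
  have hsL : SpansOverPowers p (algebraMap K Ln s) := fun z => by
    obtain ⟨a, -, ha⟩ := hG ⊤ z IntermediateField.mem_top
    exact ⟨a, ha⟩
  obtain ⟨D₁, D, hD₁, hD, hDD⟩ := exists_derivation_eq_one hsL hVt
  have hOK' (z : Ln) : z ∈ OK ↔ z ∈ (⊥ : IntermediateField K Ln) ∧ 0 ≤ V z := by
    rw [hOK, IntermediateField.mem_bot]
    have hx0 (x : K) : 0 ≤ (ι x).order ↔ 0 ≤ V (algebraMap K Ln x) := by
      rcases eq_or_ne x 0 with rfl | hx
      · simp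
      · rw [hVv, hvK x hx, WithTop.coe_nonneg, mul_nonneg_iff_of_pos_left hpn]
    constructor
    · rintro ⟨x, hx, rfl⟩
      exact ⟨⟨x, rfl⟩, (hx0 x).1 hx⟩
    · rintro ⟨⟨x, rfl⟩, hx⟩
      exact ⟨x, (hx0 x).2 hx, rfl⟩
  have hdv := map_derivation_eq_of_annihilator hbot hD hOL hOK' hle htop hD₁ hDD hd
  have hyL {i : ℕ} (hi : i < n) : y.coeff ⟨i, Nat.lt_succ_of_lt hi⟩ ∈ Ln := by
    rw [hLn]
    exact IntermediateField.subset_adjoin K _ ⟨⟨i, Nat.lt_succ_of_lt hi⟩, hi, rfl⟩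
  let uL : ℕ → Ln := fun i => if hi : i ≤ n then
    algebraMap K Ln (u.coeff ⟨i, Nat.lt_succ_of_le hi⟩) else 0
  let yL : ℕ → Ln := fun i => if hi : i < n then
    ⟨y.coeff ⟨i, Nat.lt_succ_of_lt hi⟩, hyL hi⟩ else 0
  let wL : ℕ → Ln := fun i => if i < n then yL i ^ p - yL i else
    ⟨y.coeff (Fin.last n) ^ p - y.coeff (Fin.last n), hw⟩
  have huL {i : ℕ} (hi : i ≤ n) : uL i = algebraMap K Ln (u.coeff ⟨i, Nat.lt_succ_of_le hi⟩) :=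
    dif_pos hi
  have hyL' {i : ℕ} (hi : i < n) : algebraMap Ln Ω (yL i) = y.coeff ⟨i, Nat.lt_succ_of_lt hi⟩ :=
    congrArg (algebraMap Ln Ω) (dif_pos hi)
  have htower : IsWittTower p n uL yL wL := by
    have hout (x : TruncatedWittVector p (n + 1) Ω) {i : ℕ} (hi : i ≤ n) :
        x.out.coeff i = x.coeff ⟨i, Nat.lt_succ_of_le hi⟩ :=
      x.coeff_out ⟨i, Nat.lt_succ_of_le hi⟩
    refine IsWittTower.of_map (algebraMap Ln Ω) (x := y.out)
      (z := (twMap p (n + 1) (algebraMap K Ω) u).out) (fun i hi => ?_) (fun i hi => ?_)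
      (fun i hi => ?_) fun i hi => ?_
    · rw [hout y hi]
      exact coeff_out_add_out hy ⟨i, Nat.lt_succ_of_le hi⟩
    · rw [hout _ hi, huL hi]
      rfl
    · rw [hout y hi.le, hyL' hi]
    · rw [hout y hi]
      rcases hi.lt_or_eq with hi | rfl
      · simp only [wL, if_pos hi]
        rw [map_sub, map_pow, hyL' hi]
      · simp only [wL, if_neg (lt_irrefl _)]
        rfl
  obtain ⟨g, hg⟩ := htower.exists_map_sub_eq hbot hG hD hVt hD₁ hDD (ν := ν)
    (fun i hi => by rw [huL hi]; exact IntermediateField.algebraMap_mem _ _)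
    (fun i hi => by rw [huL hi, hVv, hvK _ (hu _), hord]) hν
    (fun E hE => by
      have hle : Ln ≤ IntermediateField.lift E := by
        conv_lhs => rw [hLn]
        rw [IntermediateField.adjoin_le_iff]
        rintro _ ⟨i, hi, rfl⟩
        exact (IntermediateField.mem_lift (⟨y.coeff i, hyL hi⟩ : Ln)).2
          (by have := hE i hi; rwa [show yL i = ⟨y.coeff i, hyL hi⟩ from dif_pos hi] at this)
      rw [eq_top_iff]
      rintro z -
      exact (IntermediateField.mem_lift z).1 (hle z.2)) hdv
  refine ⟨g, ?_⟩
  simp only [wL, if_neg (lt_irrefl n)] at hg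
  rw [hμ]
  exact hg
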